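/- arXiv:math/0603279 — 2 statements merged into one kernel-verified Lean document; each statement's English description precedes it below -/
import Mathlib

section
/- Let U be a finite-dimensional right L-comodule. Then: (i) there exist a finite-dimensional right O-comodule V and a surjective L-colinear map V → U; and (ii) there exist a finite-dimensional right O-comodule W and an injective L-colinear map U → W (here V and W are regarded as L-comodules by restriction along q). -/
open TensorProduct

namespace PaperQuotient

variable {k : Type} [Field k]

section Comod

variable (k) (O : Type) [AddCommGroup O] [Module k O] [Coalgebra k O]

/-- The axioms of a right `O`-comodule structure on `V` given by the coaction `ρ`. -/
structure IsComod {V : Type} [AddCommGroup V] [Module k V]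
    (ρ : V →ₗ[k] V ⊗[k] O) : Prop where
  coassoc : ∀ v : V,
    (TensorProduct.assoc k V O O) ((TensorProduct.map ρ (LinearMap.id : O →ₗ[k] O)) (ρ v)) =
      (TensorProduct.map (LinearMap.id : V →ₗ[k] V) (Coalgebra.comul (R := k))) (ρ v)
  counit : ∀ v : V,
    (TensorProduct.rid k V)
      ((TensorProduct.map (LinearMap.id : V →ₗ[k] V) (Coalgebra.counit (R := k))) (ρ v)) = v

/-- `f : V → W` is colinear with respect to the coactions `ρV` and `ρW`. -/
def IsColinear {V W : Type} [AddCommGroup V] [Module k V] [AddCommGroup W] [Module k W]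
    (ρV : V →ₗ[k] V ⊗[k] O) (ρW : W →ₗ[k] W ⊗[k] O) (f : V →ₗ[k] W) : Prop :=
  ∀ v : V, ρW (f v) = (TensorProduct.map f (LinearMap.id : O →ₗ[k] O)) (ρV v)

/-- The map `id ⊗ ε : V ⊗ O → V`. -/
noncomputable def counitMap {V : Type} [AddCommGroup V] [Module k V] :
    V ⊗[k] O →ₗ[k] V :=
  (TensorProduct.rid k V).toLinearMap ∘ₗ
    TensorProduct.map (LinearMap.id : V →ₗ[k] V) (Coalgebra.counit (R := k))

/-- The "free" right coaction `id_V ⊗ Δ` on `V ⊗ O`. -/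
noncomputable def freeCoact {V : Type} [AddCommGroup V] [Module k V] :
    V ⊗[k] O →ₗ[k] (V ⊗[k] O) ⊗[k] O :=
  (TensorProduct.assoc k V O O).symm.toLinearMap ∘ₗ
    LinearMap.lTensor V (Coalgebra.comul (R := k))

end Comod

section CotensorDef

variable (k)
variable {O : Type} [AddCommGroup O] [Module k O] [Coalgebra k O]
variable {L : Type} [AddCommGroup L] [Module k L]

/-- The difference of the two maps `U ⊗ O → U ⊗ (L ⊗ O)` whose equalizer is the
cotensor product `U □_L O`; here `ql : O → L` is the (linear) quotient map. -/
noncomputable def cotensorObstruction (ql : O →ₗ[k] L)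
    {U : Type} [AddCommGroup U] [Module k U] (ρU : U →ₗ[k] U ⊗[k] L) :
    U ⊗[k] O →ₗ[k] U ⊗[k] (L ⊗[k] O) :=
  (TensorProduct.assoc k U L O).toLinearMap ∘ₗ
      (TensorProduct.map ρU (LinearMap.id : O →ₗ[k] O))
    - TensorProduct.map (LinearMap.id : U →ₗ[k] U)
        ((TensorProduct.map ql (LinearMap.id : O →ₗ[k] O)) ∘ₗ Coalgebra.comul (R := k))

/-- The cotensor product `U □_L O` as a subspace of `U ⊗ O`. -/
noncomputable def cotensor (ql : O →ₗ[k] L)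
    {U : Type} [AddCommGroup U] [Module k U] (ρU : U →ₗ[k] U ⊗[k] L) :
    Submodule k (U ⊗[k] O) :=
  LinearMap.ker (cotensorObstruction k ql ρU)

end CotensorDef

section HopfSetup

variable (k)
variable (O : Type) [CommRing O] [HopfAlgebra k O]

/-- `A` is a Hopf subalgebra of `O`: it is closed under comultiplication and antipode. -/
structure IsHopfSub (A : Subalgebra k O) : Prop where
  comul_mem : ∀ a ∈ A, Coalgebra.comul (R := k) a ∈
    Submodule.span k {x : O ⊗[k] O | ∃ b ∈ A, ∃ c ∈ A, x = b ⊗ₜ[k] c}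
  antipode_mem : ∀ a ∈ A, HopfAlgebra.antipode (R := k) a ∈ A

/-- The set of elements of the augmentation ideal `A⁺ = A ∩ ker ε` of `A`. -/
def augSet (A : Subalgebra k O) : Set O :=
  {a : O | a ∈ A ∧ Coalgebra.counit (R := k) a = 0}

variable (L : Type) [CommRing L] [HopfAlgebra k L]

/-- `q : O → L` realizes `L` as the quotient Hopf algebra `O ⊗_A k = O/(A⁺O)`. -/
structure IsQuotientHopf (A : Subalgebra k O) (q : O →ₐc[k] L) : Prop where
  surj : Function.Surjective q
  ker : RingHom.ker (q : O →ₐ[k] L) = Ideal.span (augSet k O A)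

/-- The coaction of `L` on an `O`-comodule obtained by restriction along `q`. -/
noncomputable def resCoact (q : O →ₐc[k] L) {V : Type} [AddCommGroup V] [Module k V]
    (ρV : V →ₗ[k] V ⊗[k] O) : V →ₗ[k] V ⊗[k] L :=
  (LinearMap.lTensor V (q : O →ₗ[k] L)) ∘ₗ ρV

/-- The multiplication map `(U ⊗ O) ⊗ O → U ⊗ O`, `(u ⊗ g) ⊗ h ↦ u ⊗ gh`. -/
noncomputable def multMap (U : Type) [AddCommGroup U] [Module k U] :
    (U ⊗[k] O) ⊗[k] O →ₗ[k] U ⊗[k] O :=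
  (LinearMap.lTensor U (LinearMap.mul' k O)) ∘ₗ (TensorProduct.assoc k U O O).toLinearMap

/-- The diagonal coaction on the tensor product of two comodules. -/
noncomputable def tensorCoact {X Y : Type} [AddCommGroup X] [Module k X]
    [AddCommGroup Y] [Module k Y]
    (ρX : X →ₗ[k] X ⊗[k] O) (ρY : Y →ₗ[k] Y ⊗[k] O) :
    X ⊗[k] Y →ₗ[k] (X ⊗[k] Y) ⊗[k] O :=
  (TensorProduct.map (LinearMap.id : X ⊗[k] Y →ₗ[k] X ⊗[k] Y) (LinearMap.mul' k O)) ∘ₗ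
    (TensorProduct.tensorTensorTensorComm k X O Y O).toLinearMap ∘ₗ
      (TensorProduct.map ρX ρY)

/-- The diagonal coaction on `X ⊗ O`, `x ⊗ a ↦ Σ (x₀ ⊗ a₁) ⊗ x₁a₂`. -/
noncomputable def diagCoact {X : Type} [AddCommGroup X] [Module k X]
    (ρX : X →ₗ[k] X ⊗[k] O) :
    X ⊗[k] O →ₗ[k] (X ⊗[k] O) ⊗[k] O :=
  tensorCoact k O ρX (Coalgebra.comul (R := k))

end HopfSetup

end PaperQuotient

namespace PaperQuotient

/-- A bundled right `O`-comodule. -/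
structure Comod (k O : Type) [Field k] [AddCommGroup O] [Module k O] [Coalgebra k O] where
  carrier : Type
  [acg : AddCommGroup carrier]
  [mod : Module k carrier]
  ρ : carrier →ₗ[k] carrier ⊗[k] O
  comod : IsComod k O ρ

attribute [instance] Comod.acg Comod.mod

end PaperQuotient

namespace PaperQuotient

open WithConv Coalgebra HopfAlgebra

section Points

variable {k O R S : Type} [Field k] [CommRing O] [HopfAlgebra k O]
  [CommRing R] [Algebra k R] [CommRing S] [Algebra k S]

/-- The product of two `R`-valued points of the affine group scheme represented by `O`. -/
noncomputable def ptMul (p r : O →ₐ[k] R) : O →ₐ[k] R := (toConv p * toConv r).ofConv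

/-- The trivial `R`-valued point. -/
noncomputable def ptOne (k O R : Type) [Field k] [CommRing O] [HopfAlgebra k O]
    [CommRing R] [Algebra k R] : O →ₐ[k] R :=
  (1 : WithConv (O →ₐ[k] R)).ofConv

/-- The inverse of an `R`-valued point. -/
noncomputable def ptInv (p : O →ₐ[k] R) : O →ₐ[k] R := p.comp (antipodeAlgHom k O)

lemma ptMul_apply (p r : O →ₐ[k] R) (x : O) :
    ptMul p r x = Algebra.TensorProduct.lift p r (fun _ _ ↦ .all ..) (comul (R := k) x) :=
  AlgHom.convMul_apply (toConv p) (toConv r) x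

lemma ptOne_apply (x : O) : ptOne k O R x = algebraMap k R (counit (R := k) x) := rfl

lemma ptInv_apply (p : O →ₐ[k] R) (x : O) : ptInv p x = p (antipode k x) := rfl

lemma ptMul_assoc (p r s : O →ₐ[k] R) : ptMul (ptMul p r) s = ptMul p (ptMul r s) :=
  congrArg ofConv (mul_assoc (toConv p) (toConv r) (toConv s))

lemma ptOne_mul (p : O →ₐ[k] R) : ptMul (ptOne k O R) p = p :=
  congrArg ofConv (one_mul (toConv p))

lemma ptMul_one (p : O →ₐ[k] R) : ptMul p (ptOne k O R) = p :=
  congrArg ofConv (mul_one (toConv p))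

lemma comp_ptMul (h : R →ₐ[k] S) (p r : O →ₐ[k] R) :
    h.comp (ptMul p r) = ptMul (h.comp p) (h.comp r) :=
  AlgHom.comp_convMul_distrib h (toConv p) (toConv r)

lemma comp_ptOne (h : R →ₐ[k] S) : h.comp (ptOne k O R) = ptOne k O S := by
  ext x
  simp [ptOne_apply]

lemma comp_ptInv (h : R →ₐ[k] S) (p : O →ₐ[k] R) : h.comp (ptInv p) = ptInv (h.comp p) := rfl

lemma ptInv_mul (p : O →ₐ[k] R) : ptMul (ptInv p) p = ptOne k O R := by
  have h := congrArg ofConv (AlgHom.antipode_id_cancel (R := k) (A := O))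
  have h' : ptMul (antipodeAlgHom k O) (AlgHom.id k O) = ptOne k O O := h
  calc ptMul (ptInv p) p = p.comp (ptMul (antipodeAlgHom k O) (AlgHom.id k O)) := by
        rw [comp_ptMul]; rfl
    _ = _ := by rw [h', comp_ptOne]

lemma ptMul_inv (p : O →ₐ[k] R) : ptMul p (ptInv p) = ptOne k O R := by
  have h' : ptMul (AlgHom.id k O) (antipodeAlgHom k O) = ptOne k O O := by
    ext x
    rw [ptMul_apply]
    have := HopfAlgebra.mul_antipode_lTensor_comul_apply (R := k) x
    rw [ptOne_apply, ← this]
    induction comul (R := k) x with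
    | zero => simp
    | add a b ha hb => simp [ha, hb]
    | tmul a b => simp
  calc ptMul p (ptInv p) = p.comp (ptMul (AlgHom.id k O) (antipodeAlgHom k O)) := by
        rw [comp_ptMul]; rfl
    _ = _ := by rw [h', comp_ptOne]

lemma ptInv_ptMul (p r : O →ₐ[k] R) : ptInv (ptMul p r) = ptMul (ptInv r) (ptInv p) := by
  have h : ptMul (ptMul p r) (ptMul (ptInv r) (ptInv p)) = ptOne k O R := by
    rw [ptMul_assoc, ← ptMul_assoc r, ptMul_inv, ptOne_mul, ptMul_inv]
  calc ptInv (ptMul p r)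
      = ptMul (ptInv (ptMul p r)) (ptMul (ptMul p r) (ptMul (ptInv r) (ptInv p))) := by
        rw [h, ptMul_one]
    _ = _ := by rw [← ptMul_assoc, ptInv_mul, ptOne_mul]

end Points

section Normal

variable {k O L R : Type} [Field k] [CommRing O] [HopfAlgebra k O]
  [CommRing L] [HopfAlgebra k L] [CommRing R] [Algebra k R]
  {A : Subalgebra k O} {q : O →ₐc[k] L}

lemma ptMul_congr (hA : IsHopfSub k O A) {p p' r r' : O →ₐ[k] R}
    (hp : ∀ a ∈ A, p a = p' a) (hr : ∀ a ∈ A, r a = r' a) :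
    ∀ a ∈ A, ptMul p r a = ptMul p' r' a := by
  intro a ha
  rw [ptMul_apply, ptMul_apply]
  refine Submodule.span_induction (p := fun x _ ↦
    Algebra.TensorProduct.lift p r (fun _ _ ↦ .all ..) x =
      Algebra.TensorProduct.lift p' r' (fun _ _ ↦ .all ..) x) ?_ ?_ ?_ ?_ (hA.comul_mem a ha)
  · rintro _ ⟨b, hb, c, hc, rfl⟩
    simp [hp b hb, hr c hc]
  · simp
  · intro x y _ _ hx hy
    simp [hx, hy]
  · intro c x _ hx
    simp [hx]

/-- The points which are trivial on `A`, that is, the points of the kernel. -/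
def IsKerPt (A : Subalgebra k O) (n : O →ₐ[k] R) : Prop := ∀ a ∈ A, n a = ptOne k O R a

lemma isKerPt_comp (hq : IsQuotientHopf k O L A q) (f : L →ₐ[k] R) :
    IsKerPt A (f.comp (q : O →ₐ[k] L)) := by
  intro a ha
  have h : a - algebraMap k O (counit (R := k) a) ∈ RingHom.ker (q : O →ₐ[k] L) := by
    rw [hq.ker]
    refine Ideal.subset_span ⟨A.sub_mem ha (A.algebraMap_mem _), ?_⟩
    simp
  have h2 : (q : O →ₐ[k] L) a = algebraMap k L (counit (R := k) a) := by
    rw [RingHom.mem_ker, map_sub, sub_eq_zero, AlgHom.commutes] at h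
    exact h
  rw [AlgHom.comp_apply, h2, AlgHom.commutes, ptOne_apply]

lemma IsKerPt.exists_eq_comp (hq : IsQuotientHopf k O L A q) {n : O →ₐ[k] R}
    (hn : IsKerPt A n) : ∃ f : L →ₐ[k] R, n = f.comp (q : O →ₐ[k] L) := by
  have hs : Function.Surjective (q : O →ₐ[k] L) := hq.surj
  have hk : RingHom.ker (q : O →ₐ[k] L) ≤ RingHom.ker n := by
    rw [hq.ker, Ideal.span_le]
    rintro a ⟨ha, h0⟩
    simp [hn a ha, ptOne_apply, h0]
  exact ⟨AlgHom.liftOfSurjective (q : O →ₐ[k] L) hs n hk,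
    (AlgHom.liftOfSurjective_comp _ hs n hk).symm⟩

lemma IsKerPt.inv (hA : IsHopfSub k O A) {n : O →ₐ[k] R} (hn : IsKerPt A n) :
    IsKerPt A (ptInv n) := by
  intro a ha
  have h := ptMul_congr hA hn (fun b _ ↦ rfl : ∀ b ∈ A, ptInv n b = ptInv n b) a ha
  rw [ptMul_inv, ptOne_mul] at h
  exact h.symm

lemma IsKerPt.conj (hA : IsHopfSub k O A) {n : O →ₐ[k] R} (hn : IsKerPt A n) (g : O →ₐ[k] R) :
    IsKerPt A (ptMul (ptMul g n) (ptInv g)) := by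
  intro a ha
  have h1 := ptMul_congr hA (fun b _ ↦ rfl : ∀ b ∈ A, g b = g b) hn
  rw [ptMul_one] at h1
  rw [ptMul_congr hA h1 (fun b _ ↦ rfl : ∀ b ∈ A, ptInv g b = ptInv g b) a ha, ptMul_inv]

/-- The right translation coaction of `L` on `O`, as an algebra homomorphism. -/
noncomputable def resComul (q : O →ₐc[k] L) : O →ₐ[k] O ⊗[k] L :=
  (Algebra.TensorProduct.map (AlgHom.id k O) (q : O →ₐ[k] L)).comp (Bialgebra.comulAlgHom k O)

lemma lift_resComul (q : O →ₐc[k] L) (g : O →ₐ[k] R) (n : L →ₐ[k] R) (x : O) :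
    Algebra.TensorProduct.lift g n (fun _ _ ↦ .all ..) (resComul q x) =
      ptMul g (n.comp (q : O →ₐ[k] L)) x := by
  rw [ptMul_apply, resComul]
  simp only [AlgHom.comp_apply, Bialgebra.comulAlgHom_apply]
  induction comul (R := k) x with
  | zero => simp
  | add a b ha hb => simp only [map_add, ha, hb]
  | tmul a b => simp

lemma resComul_eq_ptMul (q : O →ₐc[k] L) : resComul q =
    ptMul Algebra.TensorProduct.includeLeft
      (Algebra.TensorProduct.includeRight.comp (q : O →ₐ[k] L)) := by
  ext x
  rw [← lift_resComul]
  induction resComul q x with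
  | zero => simp
  | add a b ha hb => rw [map_add, ← ha, ← hb]
  | tmul a b => simp

section SemiInvariant

variable {f : O}

lemma ptMul_apply_of_semiinvariant (hq : IsQuotientHopf k O L A q)
    (hf : resComul q f = f ⊗ₜ q f) {n : O →ₐ[k] R} (hn : IsKerPt A n) (g : O →ₐ[k] R) :
    ptMul g n f = g f * n f := by
  obtain ⟨m, rfl⟩ := hn.exists_eq_comp hq
  rw [← lift_resComul, hf]
  simp

lemma ptMul_antipode_of_semiinvariant (hA : IsHopfSub k O A) (hq : IsQuotientHopf k O L A q)
    (hf : resComul q f = f ⊗ₜ q f) {n : O →ₐ[k] R} (hn : IsKerPt A n) (g : O →ₐ[k] R) :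
    ptMul n g (antipode k f) = n (antipode k f) * g (antipode k f) := by
  rw [← ptInv_apply, ptInv_ptMul, ptMul_apply_of_semiinvariant hq hf (hn.inv hA),
    ptInv_apply, ptInv_apply, mul_comm]

end SemiInvariant

end Normal

section Slice

variable {k M N : Type} [Field k] [AddCommGroup M] [Module k M] [AddCommGroup N] [Module k N]

/-- The map `id ⊗ φ : M ⊗ N → M`. -/
noncomputable def slice (M : Type) [AddCommGroup M] [Module k M] (φ : N →ₗ[k] k) :
    M ⊗[k] N →ₗ[k] M :=
  (TensorProduct.rid k M).toLinearMap ∘ₗ φ.lTensor M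

@[simp] lemma slice_tmul (φ : N →ₗ[k] k) (m : M) (n : N) :
    slice M φ (m ⊗ₜ n) = φ n • m := by
  simp [slice]

lemma eq_of_slice_eq {x y : M ⊗[k] N} (h : ∀ φ : N →ₗ[k] k, slice M φ x = slice M φ y) :
    x = y := by
  classical
  let b := Module.Basis.ofVectorSpace k N
  apply (TensorProduct.equivFinsuppOfBasisRight (M := M) b).injective
  ext i
  rw [TensorProduct.equivFinsuppOfBasisRight_apply, TensorProduct.equivFinsuppOfBasisRight_apply]
  exact h (b.coord i)

lemma exists_finiteDimensional_slice_mem (x : M ⊗[k] N) :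
    ∃ W : Submodule k M, FiniteDimensional k W ∧ ∀ φ : N →ₗ[k] k, slice M φ x ∈ W := by
  obtain ⟨s, rfl⟩ := TensorProduct.exists_finset x
  refine ⟨Submodule.span k (Prod.fst '' (s : Set (M × N))),
    FiniteDimensional.span_of_finite k (s.finite_toSet.image _), fun φ ↦ ?_⟩
  rw [map_sum]
  refine Submodule.sum_mem _ fun i hi ↦ ?_
  rw [slice_tmul]
  exact Submodule.smul_mem _ _ (Submodule.subset_span ⟨i, hi, rfl⟩)

end Slice

/-- A point of a finite-dimensional algebra in the support of a cyclic module has a nonzero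
eigenvector in that module. -/
lemma exists_eigenvector {k B M : Type} [Field k] [CommRing B] [Algebra k B]
    [FiniteDimensional k B] [AddCommGroup M] [Module B M] (ε : B →ₐ[k] k) (h : M)
    (hε : ∀ b : B, b • h = 0 → ε b = 0) :
    ∃ b : B, b • h ≠ 0 ∧ ∀ m : B, ε m = 0 → m • b • h = 0 := by
  have : IsArtinianRing B := IsArtinianRing.of_finite k B
  let P : Ideal B := RingHom.ker ε
  have hP : P.IsPrime := RingHom.ker_isPrime _
  let S : Submodule B M := Submodule.span B {h}
  have hfin : Module.Finite B S := Module.Finite.span_singleton B h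
  have hle : Module.annihilator B S ≤ P := by
    intro b hb
    have := Module.mem_annihilator.1 hb ⟨h, Submodule.mem_span_singleton_self h⟩
    exact hε b (congrArg Subtype.val this)
  have hmin : P ∈ (Module.annihilator B S).minimalPrimes := by
    refine ⟨⟨hP, hle⟩, fun I hI hIP ↦ ?_⟩
    have : I.IsPrime := hI.1
    have hmax : I.IsMaximal := IsArtinianRing.isMaximal_of_isPrime I
    exact (hmax.eq_of_le hP.ne_top hIP).ge
  obtain ⟨-, x, hx⟩ := (Submodule.isAssociatedPrime_iff).1
    (Module.associatedPrimes.minimalPrimes_annihilator_subset_associatedPrimes B S hmin)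
  obtain ⟨b, hb⟩ := Submodule.mem_span_singleton.1 x.2
  have key : ∀ m : B, m ∈ P ↔ m • b • h = 0 := by
    intro m
    rw [hx, Submodule.mem_colon_singleton, Submodule.mem_bot, hb, ← Submodule.coe_smul,
      Submodule.coe_eq_zero]
  refine ⟨b, fun h0 ↦ hP.ne_top ?_, fun m hm ↦ (key m).1 hm⟩
  rw [Ideal.eq_top_iff_one, key, one_smul, h0]

section SemiInvariant

variable {k O L : Type} [Field k] [CommRing O] [HopfAlgebra k O]
  [CommRing L] [HopfAlgebra k L] {A : Subalgebra k O} {q : O →ₐc[k] L}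

lemma slice_mul_tmul_one (φ : L →ₗ[k] k) (y : O ⊗[k] L) (x : O) :
    slice O φ (y * (x ⊗ₜ 1)) = slice O φ y * x := by
  induction y with
  | zero => simp
  | add a b ha hb => simp only [add_mul, map_add, ha, hb]
  | tmul a b => simp

lemma resComul_apply (q : O →ₐc[k] L) (x : O) :
    resComul q x = (q : O →ₗ[k] L).lTensor O (comul (R := k) x) := rfl

lemma resComul_coassoc (q : O →ₐc[k] L) (x : O) :
    TensorProduct.assoc k O L L ((resComul q).toLinearMap.rTensor L (resComul q x)) =
      (comul (R := k) (A := L)).lTensor O (resComul q x) := by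
  have h1 : ∀ y : O ⊗[k] O,
      TensorProduct.assoc k O L L ((resComul q).toLinearMap.rTensor L
        ((q : O →ₗ[k] L).lTensor O y)) =
      (TensorProduct.map (q : O →ₗ[k] L) (q : O →ₗ[k] L)).lTensor O
        (TensorProduct.assoc k O O O ((comul (R := k)).rTensor O y)) := by
    intro y
    induction y with
    | zero => simp
    | add a b ha hb => simp only [map_add, ha, hb]
    | tmul a b =>
      simp only [LinearMap.lTensor_tmul, LinearMap.rTensor_tmul, AlgHom.toLinearMap_apply,
        resComul_apply]
      induction comul (R := k) a with
      | zero => simp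
      | add c d hc hd => simp only [map_add, TensorProduct.add_tmul, hc, hd]
      | tmul c d => simp
  have h2 : ∀ y : O ⊗[k] O,
      (comul (R := k) (A := L)).lTensor O ((q : O →ₗ[k] L).lTensor O y) =
      (TensorProduct.map (q : O →ₗ[k] L) (q : O →ₗ[k] L)).lTensor O
        ((comul (R := k)).lTensor O y) := by
    intro y
    induction y with
    | zero => simp
    | add a b ha hb => simp only [map_add, ha, hb]
    | tmul a b =>
      simp only [LinearMap.lTensor_tmul]
      congr 1
      exact (CoalgHomClass.map_comp_comul_apply q b).symm
  rw [resComul_apply, h1, h2, Coalgebra.coassoc_apply]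

/-- The map `ψ ⊗ id : M ⊗ N → N`. -/
noncomputable def lslice {M : Type} [AddCommGroup M] [Module k M] (N : Type) [AddCommGroup N]
    [Module k N] (ψ : M →ₗ[k] k) : M ⊗[k] N →ₗ[k] N :=
  (TensorProduct.lid k N).toLinearMap ∘ₗ ψ.rTensor N

@[simp] lemma lslice_tmul {M N : Type} [AddCommGroup M] [Module k M] [AddCommGroup N] [Module k N]
    (ψ : M →ₗ[k] k) (m : M) (n : N) : lslice N ψ (m ⊗ₜ n) = ψ m • n := by
  simp [lslice]

lemma resComul_lslice (q : O →ₐc[k] L) (ψ : O →ₗ[k] k) (x : O) :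
    resComul q (lslice O ψ (comul (R := k) x)) =
      (lslice O ψ ∘ₗ comul (R := k)).rTensor L (resComul q x) := by
  have h1 : ∀ y : O ⊗[k] O, resComul q (lslice O ψ y) =
      (q : O →ₗ[k] L).lTensor O (lslice (O ⊗[k] O) ψ ((comul (R := k)).lTensor O y)) := by
    intro y
    induction y with
    | zero => simp
    | add a b ha hb => simp only [map_add, ha, hb]
    | tmul a b => simp [resComul_apply]
  have h2 : ∀ y : O ⊗[k] O, (q : O →ₗ[k] L).lTensor O (lslice (O ⊗[k] O) ψ
      (TensorProduct.assoc k O O O ((comul (R := k)).rTensor O y))) =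
      (lslice O ψ ∘ₗ comul (R := k)).rTensor L ((q : O →ₗ[k] L).lTensor O y) := by
    intro y
    induction y with
    | zero => simp
    | add a b ha hb => simp only [map_add, ha, hb]
    | tmul a b =>
      simp only [LinearMap.lTensor_tmul, LinearMap.rTensor_tmul, LinearMap.comp_apply]
      induction comul (R := k) a with
      | zero => simp
      | add c d hc hd => simp only [map_add, TensorProduct.add_tmul, hc, hd]
      | tmul c d => simp [TensorProduct.smul_tmul']
  rw [h1, ← Coalgebra.coassoc_apply, h2, resComul_apply]

/-- A nonzero semi-invariant element can be translated to one with counit `1`. -/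
lemma exists_counit_eq_one (q : O →ₐc[k] L) {x : O} (hx : x ≠ 0) {c : L}
    (h : resComul q x = x ⊗ₜ c) :
    ∃ y : O, counit (R := k) y = 1 ∧ resComul q y = y ⊗ₜ c := by
  obtain ⟨ψ, hψ⟩ := Module.Projective.exists_dual_ne_zero k hx
  have h1 : ∀ y : O ⊗[k] O, counit (R := k) (lslice O ψ y) =
      ψ (slice O (counit (R := k)) y) := by
    intro y
    induction y with
    | zero => simp
    | add a b ha hb => simp only [map_add, ha, hb]
    | tmul a b => simp [mul_comm]
  have h2 : slice O (counit (R := k)) (comul (R := k) x) = x := by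
    simp [slice]
  refine ⟨(ψ x)⁻¹ • lslice O ψ (comul (R := k) x), ?_, ?_⟩
  · rw [map_smul, h1, h2, smul_eq_mul, inv_mul_cancel₀ hψ]
  · rw [map_smul, resComul_lslice, h]
    simp [TensorProduct.smul_tmul']

lemma ptInv_one {R : Type} [CommRing R] [Algebra k R] :
    ptInv (ptOne k O R) = ptOne k O R := by
  rw [← ptMul_one (ptInv (ptOne k O R)), ptInv_mul]

lemma exists_inverse_semiinvariant (hA : IsHopfSub k O A) (hq : IsQuotientHopf k O L A q)
    {f : O} (hf1 : counit (R := k) f = 1) (hf : resComul q f = f ⊗ₜ q f) :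
    ∃ (x : O) (c : L), counit (R := k) x = 1 ∧ resComul q x = x ⊗ₜ c ∧ c * q f = 1 := by
  set h := antipode k f with hh
  have hh1 : counit (R := k) h = 1 := by rw [hh, counit_antipode, hf1]
  let g : O →ₐ[k] O ⊗[k] L := Algebra.TensorProduct.includeLeft
  let n : O →ₐ[k] O ⊗[k] L := Algebra.TensorProduct.includeRight.comp (q : O →ₐ[k] L)
  have hn : IsKerPt A n := isKerPt_comp hq _
  let v : O ⊗[k] L := ptMul (ptMul g n) (ptInv g) h
  have hv : resComul q h = v * (h ⊗ₜ 1) := by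
    have := ptMul_antipode_of_semiinvariant hA hq hf (hn.conj hA g) g
    rw [ptMul_assoc, ptInv_mul, ptMul_one] at this
    rw [resComul_eq_ptMul]
    exact this
  -- evaluation of the group variable at the identity
  have hvε : Algebra.TensorProduct.lift (ptOne k O L) (AlgHom.id k L) (fun _ _ ↦ .all ..) v =
      q h := by
    have h1 : (Algebra.TensorProduct.lift (ptOne k O L) (AlgHom.id k L) (fun _ _ ↦ .all ..)).comp
        g = ptOne k O L := by ext x; simp [g]
    have h2 : (Algebra.TensorProduct.lift (ptOne k O L) (AlgHom.id k L) (fun _ _ ↦ .all ..)).comp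
        n = q := by ext x; simp [n]
    rw [← AlgHom.comp_apply, comp_ptMul, comp_ptMul, comp_ptInv, h1, h2, ptInv_one, ptMul_one,
      ptOne_mul]
    rfl
  have hvone : slice O (counit (R := k) (A := L)) v = 1 := by
    let G : O ⊗[k] L →ₐ[k] O :=
      Algebra.TensorProduct.lift (AlgHom.id k O) (ptOne k L O) (fun _ _ ↦ .all ..)
    have h1 : G.comp n = ptOne k O O := by ext x; simp [n, G, ptOne_apply]
    have h2 : slice O (counit (R := k) (A := L)) v = G v := by
      induction v with
      | zero => simp
      | add a b ha hb => simp only [map_add, ha, hb]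
      | tmul a b => simp [G, ptOne_apply, Algebra.smul_def, mul_comm]
    rw [h2, ← AlgHom.comp_apply, comp_ptMul, comp_ptMul, comp_ptInv, h1, ptMul_one, ptMul_inv,
      ptOne_apply, hh1, map_one]
  -- multiplicativity in the variable of the kernel
  let a₁ : O ⊗[k] L →ₐ[k] O ⊗[k] (L ⊗[k] L) :=
    Algebra.TensorProduct.map (AlgHom.id k O) Algebra.TensorProduct.includeLeft
  let a₂ : O ⊗[k] L →ₐ[k] O ⊗[k] (L ⊗[k] L) :=
    Algebra.TensorProduct.map (AlgHom.id k O) Algebra.TensorProduct.includeRight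
  let d : O ⊗[k] L →ₐ[k] O ⊗[k] (L ⊗[k] L) :=
    Algebra.TensorProduct.map (AlgHom.id k O) (Bialgebra.comulAlgHom k L)
  have hvmul : d v = a₁ v * a₂ v := by
    have h1 : d.comp n = ptMul (a₁.comp n) (a₂.comp n) := by
      ext x
      have h2 : d.comp n x = 1 ⊗ₜ TensorProduct.map (q : O →ₗ[k] L) (q : O →ₗ[k] L)
          (comul (R := k) x) :=
        congrArg (fun y ↦ (1 : O) ⊗ₜ[k] y) (CoalgHomClass.map_comp_comul_apply q x).symm
      rw [h2, ptMul_apply]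
      induction comul (R := k) x with
      | zero => simp
      | add a b ha hb => simp only [map_add, TensorProduct.tmul_add, ha, hb]
      | tmul a b => simp [a₁, a₂, n]
    have h2 : d.comp g = a₁.comp g := by
      ext x; simp [d, a₁, g]
    have h3 : a₂.comp g = a₁.comp g := by
      ext x; simp [a₁, a₂, g, Algebra.TensorProduct.one_def]
    have hk₁ : IsKerPt A (a₁.comp n) := fun a ha ↦ by
      rw [AlgHom.comp_apply, hn a ha, ptOne_apply, ptOne_apply, AlgHom.commutes]
    have hk₂ : IsKerPt A (a₂.comp n) := fun a ha ↦ by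
      rw [AlgHom.comp_apply, hn a ha, ptOne_apply, ptOne_apply, AlgHom.commutes]
    have h4 := ptMul_antipode_of_semiinvariant hA hq hf (hk₁.conj hA (a₁.comp g))
      (ptMul (ptMul (a₁.comp g) (a₂.comp n)) (ptInv (a₁.comp g)))
    simp only [v]
    rw [← AlgHom.comp_apply, ← AlgHom.comp_apply, ← AlgHom.comp_apply]
    simp only [comp_ptMul, comp_ptInv]
    rw [h3, ← h4, h2, h1]
    congr 1
    simp only [ptMul_assoc]
    rw [← ptMul_assoc (ptInv (a₁.comp g)) (a₁.comp g), ptInv_mul, ptOne_mul]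
  have hmul : ∀ φ ψ : L →ₗ[k] k, slice O φ v * slice O ψ v =
      slice O ((LinearMap.mul' k k ∘ₗ TensorProduct.map φ ψ) ∘ₗ comul (R := k)) v := by
    intro φ ψ
    have h1 : ∀ y : O ⊗[k] L,
        slice O ((LinearMap.mul' k k ∘ₗ TensorProduct.map φ ψ) ∘ₗ comul (R := k)) y =
        slice O (LinearMap.mul' k k ∘ₗ TensorProduct.map φ ψ) (d y) := by
      intro y
      induction y with
      | zero => simp
      | add a b ha hb => simp only [map_add, ha, hb]
      | tmul a b => simp [d]
    have h2 : ∀ y z : O ⊗[k] L, slice O φ y * slice O ψ z =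
        slice O (LinearMap.mul' k k ∘ₗ TensorProduct.map φ ψ) (a₁ y * a₂ z) := by
      intro y z
      induction y with
      | zero => simp
      | add a b ha hb => simp only [map_add, add_mul, ha, hb]
      | tmul a b =>
        induction z with
        | zero => simp
        | add c e hc he => simp only [map_add, mul_add, hc, he]
        | tmul c e => simp [a₁, a₂, smul_smul, mul_comm]
    rw [h1, h2, hvmul]
  have hres : ∀ φ : L →ₗ[k] k, resComul q (slice O φ v * h) = v * ((slice O φ v * h) ⊗ₜ 1) := by
    intro φ
    have h1 : ∀ y : O ⊗[k] L, resComul q (slice O φ y) = (slice L φ).lTensor O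
        (TensorProduct.assoc k O L L ((resComul q).toLinearMap.rTensor L y)) := by
      intro y
      induction y with
      | zero => simp
      | add a b ha hb => simp only [map_add, ha, hb]
      | tmul a b =>
        simp only [slice_tmul, map_smul, LinearMap.rTensor_tmul, AlgHom.toLinearMap_apply]
        induction resComul q a with
        | zero => simp
        | add c e hc he => simp only [map_add, TensorProduct.add_tmul, smul_add, hc, he]
        | tmul c e => simp
    have h2 : ∀ y z : O ⊗[k] L, (slice L φ).lTensor O (a₁ y * a₂ z * (h ⊗ₜ 1)) =
        y * ((slice O φ z * h) ⊗ₜ 1) := by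
      intro y z
      induction y with
      | zero => simp
      | add a b ha hb => simp only [map_add, add_mul, ha, hb]
      | tmul a b =>
        induction z with
        | zero => simp
        | add c e hc he => simp only [map_add, mul_add, add_mul, TensorProduct.add_tmul, hc, he]
        | tmul c e =>
          simp [a₁, a₂, Algebra.TensorProduct.one_def, mul_assoc, TensorProduct.smul_tmul']
    have h3 : d (h ⊗ₜ 1) = h ⊗ₜ 1 := by simp [d]
    have h4 : (comul (R := k) (A := L)).lTensor O (v * (h ⊗ₜ 1)) = d (v * (h ⊗ₜ 1)) := rfl
    rw [← slice_mul_tmul_one, ← hv, h1, resComul_coassoc, hv, h4, map_mul, hvmul, h3, h2,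
      slice_mul_tmul_one]
  let B : Subalgebra k O := Submodule.toSubalgebra
    { carrier := {b | ∃ φ : L →ₗ[k] k, slice O φ v = b}
      add_mem' := by
        rintro _ _ ⟨φ, rfl⟩ ⟨ψ, rfl⟩
        exact ⟨φ + ψ, by simp [slice, LinearMap.lTensor_add]⟩
      zero_mem' := ⟨0, by simp [slice]⟩
      smul_mem' := by
        rintro c _ ⟨φ, rfl⟩
        exact ⟨c • φ, by simp [slice, LinearMap.lTensor_smul]⟩ } ⟨_, hvone⟩ (by
        rintro _ _ ⟨φ, rfl⟩ ⟨ψ, rfl⟩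
        exact ⟨_, (hmul φ ψ).symm⟩)
  have hBfin : FiniteDimensional k B := by
    obtain ⟨W, hW, hvW⟩ := exists_finiteDimensional_slice_mem v
    refine Submodule.finiteDimensional_of_le (S₁ := Subalgebra.toSubmodule B) (S₂ := W) ?_
    rintro _ ⟨φ, rfl⟩
    exact hvW φ
  obtain ⟨b, hb0, hb⟩ := exists_eigenvector
    ((Bialgebra.counitAlgHom k O).comp B.val) h (by
      intro b hb
      have := congrArg (counit (R := k)) hb
      rw [Algebra.smul_def, Bialgebra.counit_mul, hh1, mul_one, map_zero] at this
      exact this)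
  obtain ⟨φ, hφ⟩ := b.2
  have hx : resComul q (b • h) = (b • h) ⊗ₜ q h := by
    have : b • h = slice O φ v * h := by rw [hφ]; rfl
    rw [this, hres, ← this]
    refine eq_of_slice_eq fun ψ ↦ ?_
    rw [slice_mul_tmul_one, slice_tmul]
    have h1 : ∀ y : O ⊗[k] L, counit (R := k) (slice O ψ y) =
        ψ (Algebra.TensorProduct.lift (ptOne k O L) (AlgHom.id k L) (fun _ _ ↦ .all ..) y) := by
      intro y
      induction y with
      | zero => simp
      | add a b ha hb => simp only [map_add, ha, hb]
      | tmul a b => simp [ptOne_apply, Algebra.algebraMap_eq_smul_one, mul_comm]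
    let m : B := ⟨slice O ψ v, ψ, rfl⟩
    have h2 := hb (m - algebraMap k B (ψ (q h))) (by
      rw [map_sub, AlgHom.commutes, sub_eq_zero, ← hvε]
      exact h1 v)
    rw [sub_smul, sub_eq_zero, algebraMap_smul] at h2
    exact h2
  obtain ⟨x, hx1, hx⟩ := exists_counit_eq_one q hb0 hx
  refine ⟨x, q h, hx1, hx, ?_⟩
  have hq' : IsKerPt A (q : O →ₐ[k] L) := isKerPt_comp hq (AlgHom.id k L)
  have := ptMul_apply_of_semiinvariant hq hf hq' (ptInv (q : O →ₐ[k] L))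
  rw [ptInv_mul, ptOne_apply, hf1, map_one] at this
  exact this.symm

end SemiInvariant

section Coefficients

variable {k M N ι : Type} [Field k] [AddCommGroup M] [Module k M] [AddCommGroup N] [Module k N]
  [Fintype ι]

lemma eq_of_sum_tmul_eq {y : ι → M} (hy : LinearIndependent k y) {a b : ι → N}
    (h : ∑ i, y i ⊗ₜ[k] a i = ∑ i, y i ⊗ₜ[k] b i) : a = b := by
  classical
  obtain ⟨g, hg⟩ := LinearMap.exists_leftInverse_of_injective (Fintype.linearCombination k y)
    (LinearMap.ker_eq_bot.mpr (linearIndependent_iff_injective_fintypeLinearCombination.mp hy))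
  have hgy : ∀ i, g (y i) = Pi.single i 1 := fun i ↦ by
    have := LinearMap.congr_fun hg (Pi.single i 1)
    simpa using this
  funext j
  have := congrArg (lslice N (LinearMap.proj j ∘ₗ g)) h
  simpa [map_sum, hgy, Pi.single_apply] using this

lemma exists_eq_sum_tmul (e : Module.Basis ι k M) (z : M ⊗[k] N) :
    ∃ a : ι → N, z = ∑ i, e i ⊗ₜ[k] a i := by
  classical
  refine ⟨TensorProduct.equivFinsuppOfBasisLeft e z, ?_⟩
  conv_lhs => rw [← (TensorProduct.equivFinsuppOfBasisLeft e).symm_apply_apply z]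
  rw [TensorProduct.equivFinsuppOfBasisLeft_symm_apply, Finsupp.sum_fintype]
  simp

end Coefficients

/-- A matrix corepresentation of the coalgebra `H`. -/
structure IsCorep {k H n : Type} [Field k] [AddCommGroup H] [Module k H] [Coalgebra k H]
    [Fintype n] [DecidableEq n] (u : Matrix n n H) : Prop where
  comul : ∀ i j, Coalgebra.comul (R := k) (u i j) = ∑ l, u i l ⊗ₜ[k] u l j
  counit : ∀ i j, Coalgebra.counit (R := k) (u i j) = if i = j then 1 else 0

section Corep

variable {k H V n : Type} [Field k] [AddCommGroup H] [Module k H] [Coalgebra k H]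
  [AddCommGroup V] [Module k V] [Fintype n] [DecidableEq n]

lemma isCorep_of_linearIndependent {ρ : V →ₗ[k] V ⊗[k] H} (hρ : IsComod k H ρ) {y : n → V}
    (hy : LinearIndependent k y) {c : Matrix n n H} (hc : ∀ j, ρ (y j) = ∑ i, y i ⊗ₜ c i j) :
    IsCorep (k := k) c where
  comul := by
    intro i j
    have h := hρ.coassoc (y j)
    simp only [hc, map_sum, TensorProduct.map_tmul, LinearMap.id_apply, TensorProduct.sum_tmul,
      TensorProduct.assoc_tmul] at h
    rw [Finset.sum_comm] at h
    simp only [← TensorProduct.tmul_sum] at h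
    exact (congrFun (eq_of_sum_tmul_eq hy h) i).symm
  counit := by
    intro i j
    have h : ∑ i, y i ⊗ₜ[k] counit (R := k) (c i j) =
        ∑ i, y i ⊗ₜ[k] (if i = j then 1 else 0 : k) := by
      apply (TensorProduct.rid k V).injective
      have h := hρ.counit (y j)
      simp only [hc, map_sum, TensorProduct.map_tmul, LinearMap.id_apply] at h
      rw [map_sum, h]
      simp
    exact congrFun (eq_of_sum_tmul_eq hy h) i

lemma isComod_comul : IsComod k H (Coalgebra.comul (R := k) (A := H)) where
  coassoc v := Coalgebra.coassoc_apply v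
  counit v := by
    have := Coalgebra.lTensor_counit_comul (R := k) v
    exact (congrArg (TensorProduct.rid k H) this).trans (by simp)

lemma exists_subcoalgebra_mem {ι : Type} [Finite ι] (p : ι → H) :
    ∃ C : Submodule k H, FiniteDimensional k C ∧ (∀ j, p j ∈ C) ∧
      ∀ x ∈ C, Coalgebra.comul (R := k) x ∈ LinearMap.range (C.subtype.rTensor H) := by
  classical
  let b := Module.Basis.ofVectorSpace k H
  let E := TensorProduct.equivFinsuppOfBasisRight (M := H) b
  let X : ι → (_ →₀ H) := fun j ↦ E (comul (R := k) (p j))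
  have hX : ∀ j, comul (R := k) (p j) = (X j).sum fun i m ↦ m ⊗ₜ b i := fun j ↦ by
    rw [← TensorProduct.equivFinsuppOfBasisRight_symm_apply, LinearEquiv.symm_apply_apply]
  let S : Set H := ⋃ j, X j '' ((X j).support : Set _)
  have hS : S.Finite := Set.finite_iUnion fun j ↦ ((X j).support.finite_toSet.image _)
  have hXS : ∀ j i, X j i ∈ Submodule.span k S := by
    intro j i
    by_cases h : X j i = 0
    · rw [h]; exact zero_mem _
    · exact Submodule.subset_span (Set.mem_iUnion.mpr ⟨j, i, by simpa using h, rfl⟩)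
  refine ⟨Submodule.span k S, FiniteDimensional.span_of_finite k hS, fun j ↦ ?_, ?_⟩
  · have h : slice H (counit (R := k)) (comul (R := k) (p j)) = p j := isComod_comul.counit (p j)
    rw [← h, hX, Finsupp.sum, map_sum]
    refine Submodule.sum_mem _ fun i _ ↦ ?_
    rw [slice_tmul]
    exact Submodule.smul_mem _ _ (hXS j i)
  · intro x hx
    have hle : Submodule.span k S ≤ (LinearMap.range
        ((Submodule.span k S).subtype.rTensor H)).comap (comul (R := k)) := by
      rw [Submodule.span_le]
      intro x hx
      obtain ⟨j, i, _, rfl⟩ := Set.mem_iUnion.mp hx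
      have h1 : ∀ z : H ⊗[k] H, comul (R := k) (slice H (b.coord i) z) =
          slice (H ⊗[k] H) (b.coord i) ((comul (R := k)).rTensor H z) := by
        intro z
        induction z with
        | zero => simp
        | add a b ha hb => simp only [map_add, ha, hb]
        | tmul a b => simp
      have h2 : ∀ z : H ⊗[k] (H ⊗[k] H), slice (H ⊗[k] H) (b.coord i)
          ((TensorProduct.assoc k H H H).symm z) = (slice H (b.coord i)).lTensor H z := by
        intro z
        induction z with
        | zero => simp
        | add a b ha hb => simp only [map_add, ha, hb]
        | tmul a w =>
          induction w with
          | zero => simp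
          | add a b ha hb => simp only [TensorProduct.tmul_add, map_add, ha, hb]
          | tmul c d => simp
      have h3 : X j i = slice H (b.coord i) (comul (R := k) (p j)) :=
        TensorProduct.equivFinsuppOfBasisRight_apply b _ i
      have h4 : comul (R := k) (X j i) = ((slice H (b.coord i)) ∘ₗ comul (R := k)).lTensor H
          (comul (R := k) (p j)) := by
        rw [h3, h1, ← Coalgebra.coassoc_symm_apply, h2, ← LinearMap.comp_apply,
          ← LinearMap.lTensor_comp]
      rw [SetLike.mem_coe, Submodule.mem_comap]
      rw [h4, hX, Finsupp.sum, map_sum]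
      refine Submodule.sum_mem _ fun l _ ↦ ?_
      exact ⟨(⟨X j l, hXS j l⟩ : Submodule.span k S) ⊗ₜ
        (slice H (b.coord i) (comul (R := k) (b l))), by simp⟩
    exact hle hx

lemma exists_isCorep_of_basis {C : Submodule k H}
    (hC : ∀ x ∈ C, Coalgebra.comul (R := k) x ∈ LinearMap.range (C.subtype.rTensor H))
    (e : Module.Basis n k C) :
    ∃ c : Matrix n n H, IsCorep (k := k) c ∧
      ∀ j, comul (R := k) (e j : H) = ∑ i, (e i : H) ⊗ₜ c i j := by
  have h : ∀ j, ∃ a : n → H, comul (R := k) (e j : H) = ∑ i, (e i : H) ⊗ₜ a i := by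
    intro j
    obtain ⟨z, hz⟩ := hC (e j) (e j).2
    obtain ⟨a, rfl⟩ := exists_eq_sum_tmul e z
    exact ⟨a, by rw [← hz]; simp⟩
  choose a ha using h
  refine ⟨fun i j ↦ a j i, isCorep_of_linearIndependent isComod_comul
    (y := fun i ↦ (e i : H)) ?_ ha, ha⟩
  exact e.linearIndependent.map' C.subtype C.ker_subtype

end Corep

section BlockTriangular

variable {k O L r μ : Type} [Field k] [CommRing O] [HopfAlgebra k O]
  [CommRing L] [HopfAlgebra k L] {A : Subalgebra k O} {q : O →ₐc[k] L}

lemma resComul_corep {n : Type} [Fintype n] [DecidableEq n] {c : Matrix n n O}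
    (hc : IsCorep (k := k) c) (q : O →ₐc[k] L) (i j : n) :
    resComul q (c i j) = ∑ l, c i l ⊗ₜ q (c l j) := by
  rw [resComul_apply, hc.comul]
  simp

variable [Fintype r] [DecidableEq r] [Fintype μ] [DecidableEq μ]

/-- The minor of `c` on all the rows and columns in `r`, the row `a` and the column `j`. -/
noncomputable def borderedMinor (c : Matrix (r ⊕ μ) (r ⊕ μ) O) (a j : μ) : O :=
  (c.submatrix (Sum.elim Sum.inl fun _ : Unit ↦ Sum.inr a)
    (Sum.elim Sum.inl fun _ : Unit ↦ Sum.inr j)).det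

lemma counit_borderedMinor {c : Matrix (r ⊕ μ) (r ⊕ μ) O} (hc : IsCorep (k := k) c) (a j : μ) :
    counit (R := k) (borderedMinor c a j) = if a = j then 1 else 0 := by
  have h1 : counit (R := k) (borderedMinor c a j) =
      ((1 : Matrix (r ⊕ μ) (r ⊕ μ) k).submatrix (Sum.elim Sum.inl fun _ : Unit ↦ Sum.inr a)
        (Sum.elim Sum.inl fun _ : Unit ↦ Sum.inr j)).det := by
    rw [borderedMinor, ← Bialgebra.counitAlgHom_apply, AlgHom.map_det]
    congr 1
    ext x y
    simp [hc.counit, Matrix.one_apply]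
  rw [h1]
  split_ifs with h
  · subst h
    rw [Matrix.submatrix_one _ (by rintro (x | x) (y | y) <;> simp), Matrix.det_one]
  · refine Matrix.det_eq_zero_of_row_eq_zero (Sum.inr ()) ?_
    rintro (y | y) <;> simp [Matrix.one_apply, h]

variable {c : Matrix (r ⊕ μ) (r ⊕ μ) O}

lemma resComul_det_toBlocks₁₁ (hc : IsCorep (k := k) c)
    (h0 : ∀ a s, q (c (Sum.inr a) (Sum.inl s)) = 0) :
    resComul q c.toBlocks₁₁.det = c.toBlocks₁₁.det ⊗ₜ q c.toBlocks₁₁.det := by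
  have h1 : (resComul q).mapMatrix c.toBlocks₁₁ =
      (Algebra.TensorProduct.includeLeft : O →ₐ[k] O ⊗[k] L).mapMatrix c.toBlocks₁₁ *
        ((Algebra.TensorProduct.includeRight : L →ₐ[k] O ⊗[k] L).comp
          (q : O →ₐ[k] L)).mapMatrix c.toBlocks₁₁ := by
    ext x y
    simp [Matrix.mul_apply, Matrix.toBlocks₁₁, resComul_corep hc, h0]
  rw [AlgHom.map_det, h1, Matrix.det_mul, ← AlgHom.map_det, ← AlgHom.map_det]
  simp

lemma resComul_borderedMinor (hc : IsCorep (k := k) c)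
    (h0 : ∀ a s, q (c (Sum.inr a) (Sum.inl s)) = 0) (a j : μ) :
    resComul q (borderedMinor c a j) =
      ∑ i, borderedMinor c a i ⊗ₜ (q c.toBlocks₁₁.det * q (c (Sum.inr i) (Sum.inr j))) := by
  let inl : O →ₐ[k] O ⊗[k] L := Algebra.TensorProduct.includeLeft
  let inr : O →ₐ[k] O ⊗[k] L :=
    (Algebra.TensorProduct.includeRight : L →ₐ[k] O ⊗[k] L).comp (q : O →ₐ[k] L)
  let R : μ → r ⊕ Unit → r ⊕ μ := fun a ↦ Sum.elim Sum.inl fun _ ↦ Sum.inr a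
  let N : Matrix (r ⊕ Unit) (r ⊕ Unit) (O ⊗[k] L) := inl.mapMatrix (c.submatrix (R a) (R a))
  let col : μ → r ⊕ Unit → O ⊗[k] L := fun i x ↦ inl (c (R a x) (Sum.inr i))
  let T : Matrix (r ⊕ Unit) (r ⊕ Unit) (O ⊗[k] L) :=
    Matrix.fromBlocks (inr.mapMatrix c.toBlocks₁₁)
      (Matrix.of fun z _ ↦ inr (c (Sum.inl z) (Sum.inr j))) 0 1
  let w : r ⊕ Unit → O ⊗[k] L := ∑ i, inr (c (Sum.inr i) (Sum.inr j)) • col i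
  have hN : (resComul q).mapMatrix (c.submatrix (R a) (R j)) = N.updateCol (Sum.inr ()) w * T := by
    ext x y
    rcases y with y | y
    · simp [Matrix.mul_apply, R, N, T, resComul_corep hc, h0, inl, inr, Matrix.updateCol_apply,
        Matrix.toBlocks₁₁]
    · simp [Matrix.mul_apply, R, N, T, resComul_corep hc, inl, inr, Matrix.updateCol_apply,
        w, col]
  have hdet : ∀ i, (N.updateCol (Sum.inr ()) (col i)).det = inl (borderedMinor c a i) := by
    intro i
    rw [borderedMinor, AlgHom.map_det]
    congr 1
    ext x y
    rcases y with y | y <;> simp [N, R, col]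
  have hT : T.det = inr c.toBlocks₁₁.det := by
    rw [Matrix.det_fromBlocks_zero₂₁, Matrix.det_one, mul_one, AlgHom.map_det]
  have hw : (N.updateCol (Sum.inr ()) w).det =
      ∑ i, inr (c (Sum.inr i) (Sum.inr j)) * inl (borderedMinor c a i) := by
    rw [← Matrix.cramer_apply, map_sum, Finset.sum_apply]
    refine Finset.sum_congr rfl fun i _ ↦ ?_
    rw [map_smul, Pi.smul_apply, Matrix.cramer_apply, hdet, smul_eq_mul]
  have h1 : resComul q (borderedMinor c a j) =
      ((resComul q).mapMatrix (c.submatrix (R a) (R j))).det := AlgHom.map_det _ _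
  rw [h1, hN, Matrix.det_mul, hT, hw, Finset.sum_mul]
  refine Finset.sum_congr rfl fun i _ ↦ ?_
  simp [inl, inr, mul_comm]

lemma exists_matrix_resComul_eq (hA : IsHopfSub k O A) (hq : IsQuotientHopf k O L A q)
    (hc : IsCorep (k := k) c)
    (h0 : ∀ a s, q (c (Sum.inr a) (Sum.inl s)) = 0) :
    ∃ P : Matrix μ μ O, (∀ a j, counit (R := k) (P a j) = if a = j then 1 else 0) ∧
      ∀ a j, resComul q (P a j) = ∑ i, P a i ⊗ₜ q (c (Sum.inr i) (Sum.inr j)) := by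
  have hf : counit (R := k) c.toBlocks₁₁.det = 1 := by
    rw [← Bialgebra.counitAlgHom_apply, AlgHom.map_det]
    convert Matrix.det_one (n := r) (R := k)
    ext x y
    simp [Matrix.toBlocks₁₁, hc.counit, Matrix.one_apply]
  obtain ⟨x, d, hx, hxd, hd⟩ :=
    exists_inverse_semiinvariant hA hq hf (resComul_det_toBlocks₁₁ hc h0)
  refine ⟨fun a j ↦ x * borderedMinor c a j, fun a j ↦ ?_, fun a j ↦ ?_⟩
  · rw [Bialgebra.counit_mul, hx, one_mul, counit_borderedMinor hc]
  · rw [map_mul, hxd, resComul_borderedMinor hc h0, Finset.mul_sum]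
    refine Finset.sum_congr rfl fun i _ ↦ ?_
    rw [Algebra.TensorProduct.tmul_mul_tmul, ← mul_assoc, hd, one_mul]

end BlockTriangular

lemma exists_basis_adapted_to_ker {k V W : Type} [Field k] [AddCommGroup V] [Module k V]
    [FiniteDimensional k V] [AddCommGroup W] [Module k W] (f : V →ₗ[k] W) :
    ∃ (r m : ℕ) (e : Module.Basis (Fin r ⊕ Fin m) k V),
      (∀ s, f (e (Sum.inl s)) = 0) ∧ LinearIndependent k fun b ↦ f (e (Sum.inr b)) := by
  obtain ⟨K', hK⟩ := Submodule.exists_isCompl (LinearMap.ker f)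
  let e := ((Module.finBasis k (LinearMap.ker f)).prod (Module.finBasis k K')).map
    (Submodule.prodEquivOfIsCompl _ _ hK)
  have hl : ∀ s, e (Sum.inl s) = Module.finBasis k (LinearMap.ker f) s := fun s ↦ by simp [e]
  have hr : ∀ s, e (Sum.inr s) = Module.finBasis k K' s := fun s ↦ by simp [e]
  refine ⟨_, _, e, fun s ↦ ?_, ?_⟩
  · rw [hl]
    exact (Module.finBasis k (LinearMap.ker f) s).2
  · have h1 : LinearIndependent k fun b ↦ (e (Sum.inr b)) :=
      e.linearIndependent.comp _ Sum.inr_injective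
    refine h1.map (f := f) (hK.symm.disjoint.mono_left ?_)
    rw [Submodule.span_le]
    rintro _ ⟨b, rfl⟩
    simp only [hr]
    exact (Module.finBasis k K' b).2

section Embedding

variable {k O L n : Type} [Field k] [CommRing O] [HopfAlgebra k O]
  [CommRing L] [HopfAlgebra k L] {A : Subalgebra k O} {q : O →ₐc[k] L}
  [Fintype n] [DecidableEq n]

lemma exists_semiinvariant_matrix (hA : IsHopfSub k O A) (hq : IsQuotientHopf k O L A q)
    {u : Matrix n n L} (hu : IsCorep (k := k) u) :
    ∃ (m : ℕ) (P : Matrix (n × Fin m) n O),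
      (∀ a j, resComul q (P a j) = ∑ i, P a i ⊗ₜ u i j) ∧
      ∀ v : n → k, (∀ a, ∑ j, v j • P a j = 0) → v = 0 := by
  choose p hp using fun x : n × n ↦ hq.surj (u x.1 x.2)
  obtain ⟨C, hfin, hpC, hC⟩ := exists_subcoalgebra_mem (k := k) p
  obtain ⟨r, m, e, hl, hr⟩ := exists_basis_adapted_to_ker ((q : O →ₗ[k] L) ∘ₗ C.subtype)
  replace hl : ∀ s, q (e (Sum.inl s)) = 0 := hl
  replace hr : LinearIndependent k fun b ↦ q (e (Sum.inr b)) := hr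
  obtain ⟨c, hc, hce⟩ := exists_isCorep_of_basis hC e
  have hqe : ∀ x, comul (R := k) (q (e x)) =
      ∑ b, q (e (Sum.inr b)) ⊗ₜ[k] q (c (Sum.inr b) x) := by
    intro x
    rw [← CoalgHomClass.map_comp_comul_apply, hce]
    simp [hl]
  have h0 : ∀ a s, q (c (Sum.inr a) (Sum.inl s)) = 0 := by
    intro a s
    have h := hqe (Sum.inl s)
    rw [hl, map_zero] at h
    exact congrFun (eq_of_sum_tmul_eq (b := 0) hr (by rw [← h]; simp)) a
  obtain ⟨P, hP1, hP2⟩ := exists_matrix_resComul_eq hA hq hc h0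
  let π : n → Fin m → n → k := fun i b j ↦ e.repr ⟨p (i, j), hpC _⟩ (Sum.inr b)
  have hπ : ∀ i j, u i j = ∑ b, π i b j • q (e (Sum.inr b)) := by
    intro i j
    have h := congrArg ((q : O →ₗ[k] L) ∘ₗ C.subtype) (e.sum_repr ⟨p (i, j), hpC _⟩)
    rw [map_sum, Fintype.sum_sum_type] at h
    simpa [hl, hp, π] using h.symm
  have hstar : ∀ i j b, ∑ b', π i b' j • q (c (Sum.inr b) (Sum.inr b')) =
      ∑ l, π i b l • u l j := by
    intro i j b
    have h := hu.comul i j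
    conv_lhs at h => rw [hπ, map_sum]
    simp only [map_smul, hqe] at h
    have h2 : ∑ l, u i l ⊗ₜ[k] u l j =
        ∑ b, q (e (Sum.inr b)) ⊗ₜ[k] ∑ l, π i b l • u l j := by
      conv_lhs => enter [2, l]; rw [hπ i l, TensorProduct.sum_tmul]
      rw [Finset.sum_comm]
      simp only [TensorProduct.tmul_sum, TensorProduct.tmul_smul, TensorProduct.smul_tmul']
    rw [h2] at h
    refine congrFun (eq_of_sum_tmul_eq (a := fun b ↦
      ∑ b', π i b' j • q (c (Sum.inr b) (Sum.inr b'))) (b := fun b ↦ ∑ l, π i b l • u l j)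
      hr ?_) b
    rw [← h]
    simp only [Finset.smul_sum, TensorProduct.tmul_sum, TensorProduct.tmul_smul]
    exact Finset.sum_comm
  refine ⟨m, Matrix.of fun x j ↦ ∑ b, π x.1 b j • P x.2 b, fun x j ↦ ?_, fun v hv ↦ ?_⟩
  · simp only [Matrix.of_apply, map_sum, map_smul, hP2, Finset.smul_sum, TensorProduct.sum_tmul]
    rw [Finset.sum_comm, Finset.sum_comm (s := (Finset.univ : Finset n))]
    refine Finset.sum_congr rfl fun b _ ↦ ?_
    simp only [← TensorProduct.smul_tmul', ← TensorProduct.tmul_smul, ← TensorProduct.tmul_sum,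
      hstar]
  · have h1 : ∀ i a, ∑ j, v j * π i a j = 0 := by
      intro i a
      have h := congrArg (counit (R := k)) (hv (i, a))
      simpa [hP1] using h
    have h2 : ∀ i, ∑ j, v j • u i j = 0 := by
      intro i
      simp only [hπ, Finset.smul_sum]
      rw [Finset.sum_comm]
      simp only [smul_smul, ← Finset.sum_smul, h1, zero_smul, Finset.sum_const_zero]
    funext i
    have h := congrArg (counit (R := k)) (h2 i)
    simpa [hu.counit] using h

lemma exists_isCorep_intertwiner (hA : IsHopfSub k O A) (hq : IsQuotientHopf k O L A q)
    {u : Matrix n n L} (hu : IsCorep (k := k) u) :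
    ∃ (N : Type) (_ : Fintype N) (_ : DecidableEq N) (w : Matrix N N O) (π : Matrix N n k),
      IsCorep (k := k) w ∧
      (∀ a j, ∑ b, π b j • q (w a b) = ∑ i, π a i • u i j) ∧
      Function.Injective π.mulVec := by
  obtain ⟨m, P, hP, hinj⟩ := exists_semiinvariant_matrix hA hq hu
  obtain ⟨C, hfin, hpC, hC⟩ :=
    exists_subcoalgebra_mem (k := k) fun x : (n × Fin m) × n ↦ P x.1 x.2
  let e := Module.finBasis k C
  obtain ⟨c, hc, hce⟩ := exists_isCorep_of_basis hC e
  have he : LinearIndependent k fun i ↦ (e i : O) :=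
    e.linearIndependent.map' C.subtype C.ker_subtype
  let κ : n × Fin m → Fin (Module.finrank k C) → n → k :=
    fun a b j ↦ e.repr ⟨P a j, hpC (a, j)⟩ b
  have hκ : ∀ a j, P a j = ∑ b, κ a b j • (e b : O) := by
    intro a j
    have h := congrArg C.subtype (e.sum_repr ⟨P a j, hpC (a, j)⟩)
    rw [map_sum] at h
    simpa [κ] using h.symm
  refine ⟨Fin (Module.finrank k C) × (n × Fin m), inferInstance, inferInstance,
    Matrix.blockDiagonal fun _ ↦ c, Matrix.of fun x j ↦ κ x.2 x.1 j, ⟨?_, ?_⟩, ?_, ?_⟩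
  · rintro ⟨a, x⟩ ⟨b, y⟩
    by_cases h : x = y
    · subst h
      simp [Matrix.blockDiagonal_apply, Fintype.sum_prod_type, hc.comul, TensorProduct.ite_tmul]
    · simp [Matrix.blockDiagonal_apply, Fintype.sum_prod_type, TensorProduct.ite_tmul, h]
  · rintro ⟨a, x⟩ ⟨b, y⟩
    by_cases h : x = y <;> simp [Matrix.blockDiagonal_apply, hc.counit, h]
  · rintro ⟨a, x⟩ j
    have h := hP x j
    simp only [hκ, map_sum, map_smul, TensorProduct.sum_tmul, resComul_apply, hce,
      LinearMap.lTensor_tmul, Finset.smul_sum] at h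
    rw [Finset.sum_comm, Finset.sum_comm (s := (Finset.univ : Finset n))] at h
    simp only [← TensorProduct.smul_tmul', ← TensorProduct.tmul_smul, ← TensorProduct.tmul_sum]
      at h
    have h1 := congrFun (eq_of_sum_tmul_eq he h) a
    simpa [Matrix.blockDiagonal_apply, Fintype.sum_prod_type, apply_ite] using h1
  · rw [← Matrix.coe_mulVecLin, ← LinearMap.ker_eq_bot, LinearMap.ker_eq_bot']
    intro v hv
    refine hinj v fun x ↦ ?_
    simp only [hκ, Finset.smul_sum]
    rw [Finset.sum_comm]
    refine Finset.sum_eq_zero fun b _ ↦ ?_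
    have h := congrFun hv (b, x)
    simp only [Matrix.mulVecLin_apply, Matrix.mulVec, Matrix.of_apply, dotProduct, Pi.zero_apply] at h
    simp only [smul_smul, ← Finset.sum_smul]
    rw [← zero_smul k (e b : O), ← h]
    simp only [mul_comm]

end Embedding

section Antipode

variable {k H L n : Type} [Field k] [CommRing H] [HopfAlgebra k H] [CommRing L] [HopfAlgebra k L]

lemma ptInv_ptInv {R : Type} [CommRing R] [Algebra k R] (p : H →ₐ[k] R) :
    ptInv (ptInv p) = p := by
  rw [← ptMul_one (ptInv (ptInv p)), ← ptInv_mul p, ← ptMul_assoc, ptInv_mul, ptOne_mul]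

lemma antipode_antipode_apply (x : H) : antipode k (antipode k x) = x :=
  DFunLike.congr_fun (ptInv_ptInv (AlgHom.id k H)) x

lemma ptMul_comp {R : Type} [CommRing R] [Algebra k R] (p r : L →ₐ[k] R) (q : H →ₐc[k] L) :
    (ptMul p r).comp (q : H →ₐ[k] L) = ptMul (p.comp (q : H →ₐ[k] L)) (r.comp q) :=
  AlgHom.convMul_comp_bialgHom_distrib (toConv p) (toConv r) q

lemma map_antipode_apply (q : H →ₐc[k] L) (x : H) : q (antipode k x) = antipode k (q x) := by
  have h1 : ptMul ((antipodeAlgHom k L).comp (q : H →ₐ[k] L)) (q : H →ₐ[k] L) = ptOne k H L := by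
    have h2 := ptMul_comp (ptInv (AlgHom.id k L)) (AlgHom.id k L) q
    rw [ptInv_mul] at h2
    refine h2.symm.trans ?_
    ext y
    simp [ptOne_apply]
  have h3 : ptInv (q : H →ₐ[k] L) = (antipodeAlgHom k L).comp (q : H →ₐ[k] L) := by
    rw [← ptOne_mul (ptInv (q : H →ₐ[k] L)), ← h1, ptMul_assoc, ptMul_inv, ptMul_one]
  exact DFunLike.congr_fun h3 x

lemma comul_antipode (x : H) : comul (R := k) (antipode k x) =
    TensorProduct.map (antipode k) (antipode k) (TensorProduct.comm k H H (comul (R := k) x)) := by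
  have h1 : Bialgebra.comulAlgHom k H =
      ptMul Algebra.TensorProduct.includeLeft Algebra.TensorProduct.includeRight := by
    ext y
    rw [ptMul_apply, Bialgebra.comulAlgHom_apply]
    induction comul (R := k) y with
    | zero => simp
    | add a b ha hb => rw [map_add, ← ha, ← hb]
    | tmul a b => simp
  have h2 : comul (R := k) (antipode k x) = ptInv (Bialgebra.comulAlgHom k H) x := rfl
  rw [h2, h1, ptInv_ptMul, ptMul_apply]
  induction comul (R := k) x with
  | zero => simp
  | add a b ha hb => simp only [map_add, ha, hb]
  | tmul a b => simp [ptInv_apply]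

variable [Fintype n] [DecidableEq n]

lemma IsCorep.antipode_transpose {u : Matrix n n H} (hu : IsCorep (k := k) u) :
    IsCorep (k := k) (u.transpose.map (antipode k)) where
  comul i j := by
    rw [Matrix.map_apply, Matrix.transpose_apply, comul_antipode, hu.comul]
    simp
  counit i j := by
    rw [Matrix.map_apply, Matrix.transpose_apply, counit_antipode, hu.counit]
    simp only [eq_comm]

end Antipode

section Comodule

variable {k H N : Type} [Field k] [AddCommGroup H] [Module k H] [Fintype N] [DecidableEq N]

/-- The coaction on `N → k` with matrix coefficients `w`. -/
noncomputable def corepCoact (k : Type) [Field k] [Module k H] (w : Matrix N N H) :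
    (N → k) →ₗ[k] (N → k) ⊗[k] H :=
  Fintype.linearCombination k fun j ↦ ∑ i, Pi.single i 1 ⊗ₜ w i j

lemma corepCoact_single (w : Matrix N N H) (j : N) :
    corepCoact k w (Pi.single j 1) = ∑ i, Pi.single i 1 ⊗ₜ w i j := by
  rw [corepCoact, Fintype.linearCombination_apply_single, one_smul]

lemma IsCorep.isComod [Coalgebra k H] {w : Matrix N N H} (hw : IsCorep (k := k) w) :
    IsComod k H (corepCoact k w) where
  coassoc v := by
    have h : (TensorProduct.assoc k (N → k) H H).toLinearMap ∘ₗ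
        TensorProduct.map (corepCoact k w) LinearMap.id ∘ₗ corepCoact k w =
        TensorProduct.map LinearMap.id Coalgebra.comul ∘ₗ corepCoact k w := by
      refine (Pi.basisFun k N).ext fun j ↦ ?_
      simp only [Pi.basisFun_apply, LinearMap.comp_apply, corepCoact_single, map_sum,
        TensorProduct.map_tmul, LinearMap.id_apply, hw.comul, TensorProduct.sum_tmul,
        TensorProduct.tmul_sum, LinearEquiv.coe_coe, TensorProduct.assoc_tmul]
      exact Finset.sum_comm
    exact LinearMap.congr_fun h v
  counit v := by
    have h : (TensorProduct.rid k (N → k)).toLinearMap ∘ₗ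
        TensorProduct.map LinearMap.id Coalgebra.counit ∘ₗ corepCoact k w = LinearMap.id := by
      refine (Pi.basisFun k N).ext fun j ↦ ?_
      simp [corepCoact_single, hw.counit]
    exact LinearMap.congr_fun h v

end Comodule

lemma isColinear_of_basis {k H V W ι : Type} [Field k] [AddCommGroup H] [Module k H]
    [Coalgebra k H] [AddCommGroup V] [Module k V] [AddCommGroup W] [Module k W]
    {ρV : V →ₗ[k] V ⊗[k] H} {ρW : W →ₗ[k] W ⊗[k] H} {f : V →ₗ[k] W} (b : Module.Basis ι k V)
    (h : ∀ i, ρW (f (b i)) = TensorProduct.map f LinearMap.id (ρV (b i))) :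
    IsColinear k H ρV ρW f :=
  LinearMap.congr_fun (b.ext h : ρW ∘ₗ f = TensorProduct.map f LinearMap.id ∘ₗ ρV)

section Main

variable {k O L n U : Type} [Field k] [CommRing O] [HopfAlgebra k O]
  [CommRing L] [HopfAlgebra k L] {A : Subalgebra k O} {q : O →ₐc[k] L}
  [Fintype n] [DecidableEq n] [AddCommGroup U] [Module k U]
  {ρU : U →ₗ[k] U ⊗[k] L} {e : Module.Basis n k U} {u : Matrix n n L}

lemma exists_injective_colinear (hA : IsHopfSub k O A) (hq : IsQuotientHopf k O L A q)
    (hu : IsCorep (k := k) u) (he : ∀ j, ρU (e j) = ∑ i, e i ⊗ₜ u i j) :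
    ∃ (W : Comod k O) (g : U →ₗ[k] W.carrier), FiniteDimensional k W.carrier ∧
      Function.Injective g ∧ IsColinear k L ρU (resCoact k O L q W.ρ) g := by
  obtain ⟨N, _, _, w, π, hw, hπ, hinj⟩ := exists_isCorep_intertwiner hA hq hu
  let g : U →ₗ[k] (N → k) := π.mulVecLin ∘ₗ e.equivFun.toLinearMap
  have hg : ∀ j, g (e j) = ∑ a, π a j • Pi.single a (1 : k) := by
    intro j
    ext a
    simp [g, Finset.sum_apply, Pi.single_apply, Finsupp.single_eq_pi_single]
  refine ⟨⟨N → k, corepCoact k w, hw.isComod⟩, g, inferInstanceAs (FiniteDimensional k (N → k)),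
    hinj.comp e.equivFun.injective, isColinear_of_basis e fun j ↦ ?_⟩
  rw [he, hg]
  simp only [resCoact, LinearMap.comp_apply, map_sum, map_smul, corepCoact_single,
    LinearMap.lTensor_tmul, TensorProduct.map_tmul, LinearMap.id_apply, hg,
    TensorProduct.sum_tmul, Finset.smul_sum]
  rw [Finset.sum_comm, Finset.sum_comm (s := (Finset.univ : Finset n))]
  refine Finset.sum_congr rfl fun a _ ↦ ?_
  simp only [← TensorProduct.smul_tmul', ← TensorProduct.tmul_smul, ← TensorProduct.tmul_sum]
  exact congrArg _ (hπ a j)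

lemma exists_surjective_colinear (hA : IsHopfSub k O A) (hq : IsQuotientHopf k O L A q)
    (hu : IsCorep (k := k) u) (he : ∀ j, ρU (e j) = ∑ i, e i ⊗ₜ u i j) :
    ∃ (V : Comod k O) (f : V.carrier →ₗ[k] U), FiniteDimensional k V.carrier ∧
      Function.Surjective f ∧ IsColinear k L (resCoact k O L q V.ρ) ρU f := by
  obtain ⟨N, _, _, w, π, hw, hπ, hinj⟩ :=
    exists_isCorep_intertwiner hA hq hu.antipode_transpose
  have hπ' : ∀ a j, ∑ b, π b j • q (antipode k (w a b)) = ∑ i, π a i • u j i := by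
    intro a j
    have h := congrArg (antipode k) (hπ a j)
    simpa [map_antipode_apply, antipode_antipode_apply] using h
  obtain ⟨B, hB⟩ := LinearMap.exists_leftInverse_of_injective π.mulVecLin
    (LinearMap.ker_eq_bot.mpr hinj)
  have hBπ : LinearMap.toMatrix' B * π = 1 := by
    rw [← LinearMap.toMatrix'_id, ← hB, LinearMap.toMatrix'_comp, ← Matrix.toLin'_apply',
      LinearMap.toMatrix'_toLin']
  let f : (N → k) →ₗ[k] U := Fintype.linearCombination k fun a ↦ ∑ j, π a j • e j
  have hf : ∀ a, f (Pi.single a 1) = ∑ j, π a j • e j := by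
    intro a
    simp only [f, Fintype.linearCombination_apply_single, one_smul]
  refine ⟨⟨N → k, corepCoact k (w.transpose.map (antipode k)), hw.antipode_transpose.isComod⟩, f,
    inferInstanceAs (FiniteDimensional k (N → k)), ?_,
    isColinear_of_basis (Pi.basisFun k N) fun a ↦ ?_⟩
  · rw [← LinearMap.range_eq_top, eq_top_iff, ← e.span_eq, Submodule.span_le]
    rintro _ ⟨j, rfl⟩
    refine ⟨LinearMap.toMatrix' B j, ?_⟩
    simp only [f, Fintype.linearCombination_apply, Finset.smul_sum, smul_smul]
    rw [Finset.sum_comm]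
    simp only [← Finset.sum_smul, ← Matrix.mul_apply, hBπ, Matrix.one_apply]
    simp
  · rw [Pi.basisFun_apply, hf]
    simp only [resCoact, LinearMap.comp_apply, map_sum, map_smul, corepCoact_single,
      LinearMap.lTensor_tmul, TensorProduct.map_tmul, LinearMap.id_apply, hf, he,
      TensorProduct.sum_tmul, Finset.smul_sum, Matrix.map_apply, Matrix.transpose_apply]
    rw [Finset.sum_comm, Finset.sum_comm (s := (Finset.univ : Finset N))]
    refine Finset.sum_congr rfl fun j _ ↦ ?_
    simp only [← TensorProduct.smul_tmul', ← TensorProduct.tmul_smul, ← TensorProduct.tmul_sum]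
    exact congrArg _ (hπ' a j).symm

end Main

end PaperQuotient

open PaperQuotient in
/-- Every finite-dimensional right `L`-comodule `U` is (i) a quotient
of the restriction of a finite-dimensional right `O`-comodule and (ii) embeds into the
restriction of a finite-dimensional right `O`-comodule. -/
theorem statement6
    (k : Type) [Field k] (O : Type) [CommRing O] [HopfAlgebra k O]
    (A : Subalgebra k O) (hA : IsHopfSub k O A)
    (L : Type) [CommRing L] [HopfAlgebra k L]
    (q : O →ₐc[k] L) (hq : IsQuotientHopf k O L A q)
    (U : Type) [AddCommGroup U] [Module k U] [FiniteDimensional k U]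
    (ρU : U →ₗ[k] U ⊗[k] L) (hU : IsComod k L ρU) :
    (∃ (V : Comod k O) (f : V.carrier →ₗ[k] U),
        FiniteDimensional k V.carrier ∧
        Function.Surjective f ∧
        IsColinear k L (resCoact k O L q V.ρ) ρU f) ∧
    (∃ (W : Comod k O) (g : U →ₗ[k] W.carrier),
        FiniteDimensional k W.carrier ∧
        Function.Injective g ∧
        IsColinear k L ρU (resCoact k O L q W.ρ) g) := by
  obtain ⟨u, hu⟩ : ∃ u : Matrix (Fin (Module.finrank k U)) (Fin (Module.finrank k U)) L,
      ∀ j, ρU (Module.finBasis k U j) = ∑ i, Module.finBasis k U i ⊗ₜ u i j := by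
    choose a ha using fun j ↦ exists_eq_sum_tmul (Module.finBasis k U) (ρU (Module.finBasis k U j))
    exact ⟨Matrix.of fun i j ↦ a j i, ha⟩
  have hc := isCorep_of_linearIndependent hU (Module.finBasis k U).linearIndependent hu
  exact ⟨exists_surjective_colinear hA hq hc hu, exists_injective_colinear hA hq hc hu⟩
end

section
/- Let V be a right O-comodule and let V^{co L} = { v ∈ V : (id_V ⊗ q)(ρ_V(v)) = v ⊗ q(1) } be its subspace of L-coinvariants. Then ρ_V(V^{co L}) ⊆ V^{co L} ⊗_k A; in particular V^{co L} is an O-subcomodule of V whose coaction factors through the Hopf subalgebra A. -/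
open TensorProduct

namespace PaperQuotient
section Minors

theorem multilinear_mem_of_mem_span {R M : Type*} [CommRing R] [AddCommGroup M] [Module R M]
    {ι : Type*} [Finite ι] (f : MultilinearMap R (fun _ : ι => M) R) (S : Set M) (I : Ideal R)
    (hf : ∀ w : ι → M, (∀ i, w i ∈ S) → f w ∈ I)
    (v : ι → M) (hv : ∀ i, v i ∈ Submodule.span R S) : f v ∈ I := by
  classical
  have := Fintype.ofFinite ι
  suffices H : ∀ (t : Finset ι) (v : ι → M), (∀ i ∈ t, v i ∈ Submodule.span R S) →
      (∀ i ∉ t, v i ∈ S) → f v ∈ I from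
    H Finset.univ v (fun i _ => hv i) (fun i hi => absurd (Finset.mem_univ i) hi)
  intro t
  induction t using Finset.induction_on with
  | empty => exact fun v _ h => hf v fun i => h i (Finset.notMem_empty i)
  | insert a t ha ih =>
    intro v h₁ h₂
    have key : Submodule.span R S ≤ Submodule.comap (f.toLinearMap v a) I := by
      refine Submodule.span_le.2 fun m hm => ?_
      refine ih _ (fun i hi => ?_) (fun i hi => ?_)
      · rw [Function.update_of_ne (ne_of_mem_of_not_mem hi ha)]
        exact h₁ i (Finset.mem_insert_of_mem hi)
      · by_cases hia : i = a
        · subst hia; simpa using hm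
        · rw [Function.update_of_ne hia]
          exact h₂ i (by simp [hia, hi])
    have := key (h₁ a (Finset.mem_insert_self a t))
    simpa using this

variable {A : Type*} [CommRing A] {n : ℕ}

/-- The ideal generated by the `r × r` minors of the matrices whose rows lie in `K`. -/
def minorIdeal (K : Submodule A (Fin n → A)) (r : ℕ) : Ideal A :=
  Ideal.span {x | ∃ w : Fin r → Fin n → A, (∀ i, w i ∈ K) ∧
    ∃ s : Fin r → Fin n, x = (Matrix.of fun i j => w i (s j)).det}

theorem minorIdeal_zero (K : Submodule A (Fin n → A)) : minorIdeal K 0 = ⊤ :=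
  (Ideal.eq_top_iff_one _).2 <| Ideal.subset_span
    ⟨fun i => i.elim0, fun i => i.elim0, fun i => i.elim0, by simp⟩

theorem minorIdeal_eq_bot_of_lt (K : Submodule A (Fin n → A)) {r : ℕ} (hr : n < r) :
    minorIdeal K r = ⊥ := by
  refine Ideal.span_eq_bot.2 ?_
  rintro _ ⟨w, -, s, rfl⟩
  obtain ⟨i, j, hij, h⟩ := Fintype.exists_ne_map_eq_of_card_lt s (by simpa using hr)
  exact Matrix.det_zero_of_column_eq hij fun l => by simp [h]

theorem det_mul_mem {r m : ℕ} (U : Matrix (Fin r) (Fin m) A) (N : Matrix (Fin m) (Fin r) A)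
    (I : Ideal A) (hU : ∀ s : Fin r → Fin m, (U.submatrix id s).det ∈ I) : (U * N).det ∈ I := by
  rw [← Matrix.det_transpose]
  refine multilinear_mem_of_mem_span (Matrix.detRowAlternating (R := A) (n := Fin r)).toMultilinearMap
    (Set.range U.transpose) I (fun w hw => ?_) _ (fun i => ?_)
  · choose s hs using hw
    obtain rfl : (fun i => U.transpose (s i)) = w := funext hs
    have := hU s
    rwa [← Matrix.det_transpose] at this
  · have : (U * N).transpose i = ∑ p, N p i • U.transpose p := by
      ext l
      simp [Matrix.mul_apply, Finset.sum_apply, mul_comm]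
    rw [this]
    exact Submodule.sum_mem _ fun p _ => Submodule.smul_mem _ _ (Submodule.subset_span ⟨p, rfl⟩)

theorem map_minorIdeal_le {B : Type*} [CommRing B] (d j : A →+* B) (K : Submodule A (Fin n → A))
    (T T' : Matrix (Fin n) (Fin n) B) (hT : T * T' = 1)
    (hK : ∀ a ∈ K, Matrix.vecMul (d ∘ a) T ∈
      Submodule.span B {x : Fin n → B | ∃ a' ∈ K, x = j ∘ a'}) (r : ℕ) :
    (minorIdeal K r).map d ≤ (minorIdeal K r).map j := by
  rw [minorIdeal, Ideal.map_span, Ideal.span_le]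
  rintro _ ⟨_, ⟨w, hw, s, rfl⟩, rfl⟩
  rw [SetLike.mem_coe, RingHom.map_det]
  have e : d.mapMatrix (Matrix.of fun i l => w i (s l)) =
      (Matrix.of fun i => Matrix.vecMul (d ∘ w i) T) * T'.submatrix id s := by
    have h : (Matrix.of fun i => Matrix.vecMul (d ∘ w i) T) = (Matrix.of fun i => d ∘ w i) * T := by
      ext i l; simp [Matrix.mul_apply, Matrix.vecMul, dotProduct]
    have h' : T'.submatrix id s = T' * (1 : Matrix (Fin n) (Fin n) B).submatrix id s := by
      ext i l; simp [Matrix.mul_apply, Matrix.one_apply]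
    rw [h, h', Matrix.mul_assoc, ← Matrix.mul_assoc T, hT, Matrix.one_mul]
    ext i l; simp [Matrix.mul_apply, Matrix.one_apply]
  rw [e]
  refine det_mul_mem _ _ _ fun s' => ?_
  refine multilinear_mem_of_mem_span
    ((Matrix.detRowAlternating (R := B) (n := Fin r)).toMultilinearMap.compLinearMap
      fun _ => LinearMap.funLeft B B s') {x : Fin n → B | ∃ a' ∈ K, x = j ∘ a'} _
      (fun v hv => ?_) (fun i => Matrix.vecMul (d ∘ w i) T) (fun i => hK _ (hw i))
  choose a ha hva using hv
  obtain rfl : v = fun i => j ∘ a i := funext hva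
  have := Ideal.mem_map_of_mem j (Ideal.subset_span ⟨a, ha, s', rfl⟩ :
    (Matrix.of fun i l => a i (s' l)).det ∈ minorIdeal K r)
  rw [RingHom.map_det] at this
  exact this

theorem det_mul_bordered {r : ℕ} (M : Matrix (Fin r) (Fin r) A) (c b : Fin r → A) (e : A)
    (h : (Matrix.fromBlocks M (Matrix.replicateCol (Fin 1) c) (Matrix.replicateRow (Fin 1) b)
      (Matrix.of fun _ _ => e)).det = 0) :
    M.det * dotProduct (Matrix.vecMul b M.adjugate) c = M.det ^ 2 * e := by
  have h₁ := congrArg Matrix.det (Matrix.fromBlocks_multiply M (Matrix.replicateCol (Fin 1) c)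
    (Matrix.replicateRow (Fin 1) b) (Matrix.of fun _ _ => e)
    (1 : Matrix (Fin r) (Fin r) A) (-(M.adjugate * Matrix.replicateCol (Fin 1) c)) 0
    (Matrix.of fun _ _ => M.det))
  have h₂ : M * -(M.adjugate * Matrix.replicateCol (Fin 1) c) +
      Matrix.replicateCol (Fin 1) c *
        (Matrix.of fun _ _ => M.det : Matrix (Fin 1) (Fin 1) A) = 0 := by
    rw [Matrix.mul_neg, ← Matrix.mul_assoc, Matrix.mul_adjugate]
    ext i l
    simp [Matrix.mul_apply, mul_comm]
  rw [Matrix.det_mul, h, zero_mul, h₂, Matrix.det_fromBlocks_zero₁₂] at h₁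
  simp only [mul_one, Matrix.mul_zero, add_zero, Matrix.det_fin_one] at h₁
  have h₃ : (Matrix.replicateRow (Fin 1) b * (M.adjugate * Matrix.replicateCol (Fin 1) c)) 0 0 =
      dotProduct (Matrix.vecMul b M.adjugate) c := by
    rw [← Matrix.mul_assoc, ← Matrix.replicateRow_vecMul]
    simp [Matrix.mul_apply, dotProduct]
  simp only [Matrix.add_apply, Matrix.mul_neg, Matrix.neg_apply, h₃] at h₁
  simp [Matrix.mul_apply] at h₁
  linear_combination h₁

theorem exists_retraction (K : Submodule A (Fin n → A)) (r : ℕ) (h₁ : minorIdeal K r = ⊤)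
    (h₀ : minorIdeal K (r + 1) = ⊥) :
    ∃ f : (Fin n → A) →ₗ[A] K, ∀ x : K, f x = x := by
  let J : Ideal A :=
    { carrier := {a | ∃ f : (Fin n → A) →ₗ[A] K, ∀ x : K, f x = a • x}
      add_mem' := by
        rintro a b ⟨f, hf⟩ ⟨g, hg⟩
        exact ⟨f + g, fun x => by simp [hf, hg, add_smul]⟩
      zero_mem' := ⟨0, fun x => by simp⟩
      smul_mem' := by
        rintro c a ⟨f, hf⟩
        exact ⟨c • f, fun x => by simp [hf, mul_smul]⟩ }
  suffices H : J = ⊤ by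
    obtain ⟨f, hf⟩ := (Ideal.eq_top_iff_one J).1 H
    exact ⟨f, fun x => by simpa using hf x⟩
  rw [← top_le_iff, ← Ideal.span_pow_eq_top _ h₁ 2, Ideal.span_le]
  rintro _ ⟨_, ⟨w, hw, s, rfl⟩, rfl⟩
  set M : Matrix (Fin r) (Fin r) A := Matrix.of fun i j => w i (s j) with hM
  refine ⟨M.det • ∑ i, ((LinearMap.proj i ∘ₗ Matrix.vecMulLinear M.adjugate ∘ₗ
    LinearMap.funLeft A A s).smulRight (⟨w i, hw i⟩ : K)), fun x => ?_⟩
  ext p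
  have key := det_mul_bordered M (fun i => w i p) (fun l => (x : Fin n → A) (s l))
    ((x : Fin n → A) p) (by
      have hmem : (Matrix.of fun i l => (Fin.append w (fun _ : Fin 1 => (x : Fin n → A))) i
          ((Fin.append s (fun _ : Fin 1 => p)) l)).det ∈ minorIdeal K (r + 1) :=
        Ideal.subset_span ⟨_, fun i => by
          refine Fin.addCases (fun i => ?_) (fun i => ?_) i
          · simpa using hw i
          · simp, _, rfl⟩
      rw [h₀, Ideal.mem_bot, ← Matrix.det_submatrix_equiv_self finSumFinEquiv] at hmem
      rw [← hmem]
      congr 1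
      ext i l
      rcases i with i | i <;> rcases l with l | l <;> simp [hM])
  simp only [dotProduct] at key
  simpa [Finset.sum_apply, LinearMap.funLeft, Function.comp_def] using key

end Minors

section Subcomodule

variable {k : Type*} [Field k] {O : Type*} [CommRing O] [HopfAlgebra k O]

/-- The `k`-subspaces `W` of `O` such that `Δ(W) ⊆ W ⊗ O`. -/
def IsRightCoideal (W : Submodule k O) : Prop :=
  ∀ w ∈ W, Coalgebra.comul (R := k) w ∈
    Submodule.span k {z : O ⊗[k] O | ∃ w' ∈ W, ∃ o, z = w' ⊗ₜ[k] o}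

theorem IsRightCoideal.iSup {ι : Sort*} {W : ι → Submodule k O} (h : ∀ i, IsRightCoideal (W i)) :
    IsRightCoideal (⨆ i, W i) := by
  have : (⨆ i, W i) ≤ (Submodule.span k {z : O ⊗[k] O | ∃ w' ∈ ⨆ i, W i, ∃ o,
      z = w' ⊗ₜ[k] o}).comap (Coalgebra.comul (R := k)) := by
    refine iSup_le fun i w hw => ?_
    refine Submodule.span_mono ?_ (h i w hw)
    rintro _ ⟨w', hw', o, rfl⟩
    exact ⟨w', Submodule.mem_iSup_of_mem i hw', o, rfl⟩
  exact this

theorem exists_isRightCoideal (x : O) :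
    ∃ W : Submodule k O, Module.Finite k W ∧ x ∈ W ∧ IsRightCoideal W := by
  classical
  let b := Module.Basis.ofVectorSpace k O
  let y := (Algebra.TensorProduct.basis O b).repr (Coalgebra.comul (R := k) x)
  have hx : Coalgebra.comul (R := k) x = ∑ i ∈ y.support, y i ⊗ₜ[k] b i := by
    rw [← (Algebra.TensorProduct.basis O b).linearCombination_repr (Coalgebra.comul (R := k) x),
      Finsupp.linearCombination_apply, Finsupp.sum]
    refine Finset.sum_congr rfl fun i _ => ?_
    simp [y, TensorProduct.smul_tmul']
  refine ⟨Submodule.span k (y.support.image y), inferInstance, ?_, ?_⟩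
  · have h := Coalgebra.lTensor_counit_comul (R := k) x
    rw [hx] at h
    have h' := congrArg (TensorProduct.rid k O) h
    simp only [map_sum, LinearMap.lTensor_tmul, TensorProduct.rid_tmul, one_smul] at h'
    rw [← h']
    exact Submodule.sum_mem _ fun i hi => Submodule.smul_mem _ _
      (Submodule.subset_span (Finset.mem_coe.2 (Finset.mem_image_of_mem y hi)))
  · intro w hw
    refine Submodule.span_le (p := (Submodule.span k _).comap (Coalgebra.comul (R := k))).2 ?_ hw
    intro w hw
    obtain ⟨i, hi, rfl⟩ := Finset.mem_image.1 hw
    have h := Coalgebra.coassoc_apply (R := k) x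
    rw [hx] at h
    have h' := congrArg ((TensorProduct.rid k (O ⊗[k] O)).toLinearMap ∘ₗ (b.coord i).lTensor (O ⊗[k] O) ∘ₗ
      (TensorProduct.assoc k O O O).symm.toLinearMap) h
    have hl : ∀ j, b.coord i (b j) = if i = j then 1 else 0 := fun j => by
      simp [Finsupp.single_apply, eq_comm]
    simp only [map_sum, LinearMap.rTensor_tmul, LinearMap.comp_apply, LinearEquiv.coe_coe,
      LinearEquiv.symm_apply_apply, LinearMap.lTensor_tmul, TensorProduct.rid_tmul, hl, ite_smul,
      one_smul, zero_smul, Finset.sum_ite_eq, if_pos hi] at h'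
    rw [SetLike.mem_coe, Submodule.mem_comap, h']
    refine Submodule.sum_mem _ fun j hj => ?_
    have hm : y j ∈ Submodule.span k (y.support.image y : Set O) :=
      Submodule.subset_span (Finset.mem_coe.2 (Finset.mem_image_of_mem y hj))
    generalize Coalgebra.comul (R := k) (b j) = z
    induction z with
    | zero => simp
    | add z₁ z₂ h₁ h₂ =>
      rw [TensorProduct.tmul_add, map_add, map_add, map_add]
      exact add_mem h₁ h₂
    | tmul u v =>
      refine Submodule.subset_span ⟨y j, hm, (b.coord i v) • u, ?_⟩
      simp [TensorProduct.smul_tmul']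

theorem sum_tmul_injective {V U : Type*} [AddCommGroup V] [Module k V] [AddCommGroup U]
    [Module k U] {n : ℕ} {c : Fin n → V} (hc : LinearIndependent k c) {u u' : Fin n → U}
    (h : ∑ i, c i ⊗ₜ[k] u i = ∑ i, c i ⊗ₜ[k] u' i) : u = u' := by
  classical
  obtain ⟨g, hg⟩ := (Finsupp.linearCombination k c).exists_leftInverse_of_injective
    (LinearMap.ker_eq_bot.2 hc)
  funext l
  have h' := congrArg ((TensorProduct.lid k U).toLinearMap ∘ₗ (Finsupp.lapply l ∘ₗ g).rTensor U) h
  have hl : ∀ j, g (c j) = Finsupp.single j 1 := fun j => by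
    simpa using LinearMap.congr_fun hg (Finsupp.single j 1)
  simpa [hl, Finsupp.single_apply, ite_smul] using h'

/-- A matrix coaction on linearly independent vectors is given by an invertible matrix. -/
theorem exists_matrix_of_isRightCoideal (W : Submodule k O) [Module.Finite k W]
    (hW : IsRightCoideal W) :
    ∃ (n : ℕ) (c : Fin n → O) (t t' : Matrix (Fin n) (Fin n) O),
      W = Submodule.span k (Set.range c) ∧
      (∀ j, Coalgebra.comul (R := k) (c j) = ∑ i, c i ⊗ₜ[k] t j i) ∧ t * t' = 1 := by
  let b := Module.finBasis k W
  let c : Fin (Module.finrank k W) → O := fun i => b i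
  have hc : LinearIndependent k c := b.linearIndependent.map' W.subtype (by simp)
  have hspan : W = Submodule.span k (Set.range c) := by
    have : Set.range c = W.subtype '' Set.range b := by
      rw [← Set.range_comp]; rfl
    rw [this, Submodule.span_image, b.span_eq, Submodule.map_top, Submodule.range_subtype]
  have ht : ∀ j, ∃ t : Fin (Module.finrank k W) → O,
      Coalgebra.comul (R := k) (c j) = ∑ i, c i ⊗ₜ[k] t i := by
    intro j
    have := hW (c j) (b j).2
    generalize Coalgebra.comul (R := k) (c j) = z at this ⊢
    induction this using Submodule.span_induction with
    | mem z hz =>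
      obtain ⟨w, hw, o, rfl⟩ := hz
      rw [hspan] at hw
      obtain ⟨e, rfl⟩ := (Submodule.mem_span_range_iff_exists_fun k).1 hw
      exact ⟨fun i => e i • o, by simp [TensorProduct.sum_tmul, TensorProduct.smul_tmul]⟩
    | zero => exact ⟨0, by simp⟩
    | add z₁ z₂ _ _ h₁ h₂ =>
      obtain ⟨t₁, rfl⟩ := h₁
      obtain ⟨t₂, rfl⟩ := h₂
      exact ⟨t₁ + t₂, by simp [TensorProduct.tmul_add, Finset.sum_add_distrib]⟩
    | smul a z _ h =>
      obtain ⟨t, rfl⟩ := h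
      exact ⟨a • t, by simp [Finset.smul_sum]⟩
  choose t ht using ht
  have hcomul : ∀ j l, Coalgebra.comul (R := k) (t j l) = ∑ i, t i l ⊗ₜ[k] t j i := by
    intro j
    refine congrFun (sum_tmul_injective hc ?_)
    have h := Coalgebra.coassoc_apply (R := k) (c j)
    simp only [ht, map_sum, LinearMap.rTensor_tmul, LinearMap.lTensor_tmul, TensorProduct.sum_tmul,
      TensorProduct.assoc_tmul] at h
    rw [← h, Finset.sum_comm]
    simp [TensorProduct.tmul_sum]
  have hcounit : ∀ j l, Coalgebra.counit (R := k) (t j l) = if j = l then 1 else 0 := by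
    intro j
    refine congrFun (sum_tmul_injective hc ?_)
    have h := Coalgebra.lTensor_counit_comul (R := k) (c j)
    simp only [ht, map_sum, LinearMap.lTensor_tmul] at h
    rw [h]
    simp [TensorProduct.tmul_ite]
  refine ⟨_, c, Matrix.of t, Matrix.of fun i l => HopfAlgebra.antipode k (t i l), hspan, ht, ?_⟩
  ext j l
  have h := HopfAlgebra.mul_antipode_rTensor_comul_apply (R := k) (t j l)
  rw [hcomul, hcounit] at h
  simp only [map_sum, LinearMap.rTensor_tmul, LinearMap.mul'_apply] at h
  rw [Matrix.mul_apply, Matrix.one_apply]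
  simp only [Matrix.of_apply, mul_comm (t j _), h]
  split_ifs <;> simp

theorem exists_matrix_coaction {m : ℕ} (x : Fin m → O) :
    ∃ (n : ℕ) (c : Fin n → O) (t t' : Matrix (Fin n) (Fin n) O),
      (∀ i, x i ∈ Submodule.span k (Set.range c)) ∧
      (∀ j, Coalgebra.comul (R := k) (c j) = ∑ i, c i ⊗ₜ[k] t j i) ∧ t * t' = 1 := by
  choose W hW hx hco using fun i => exists_isRightCoideal (k := k) (x i)
  have : Module.Finite k (⨆ i, W i : Submodule k O) := Submodule.finite_iSup W
  obtain ⟨n, c, t, t', h₁, h₂, h₃⟩ := exists_matrix_of_isRightCoideal _ (IsRightCoideal.iSup hco)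
  exact ⟨n, c, t, t', fun i => h₁ ▸ Submodule.mem_iSup_of_mem i (hx i), h₂, h₃⟩

end Subcomodule

section HopfSubalgebra

variable {k : Type} [Field k] {O : Type} [CommRing O] [HopfAlgebra k O] {A : Subalgebra k O}

theorem IsHopfSub.exists_comul (hA : IsHopfSub k O A) :
    ∃ D : A →ₐ[k] A ⊗[k] A, ∀ a : A,
      Algebra.TensorProduct.map A.val A.val (D a) = Coalgebra.comul (R := k) (a : O) := by
  let ψ := Algebra.TensorProduct.map A.val A.val
  have hψ : Function.Injective ψ :=
    Module.Flat.tensorProduct_mapIncl_injective_of_left (R := k) (Subalgebra.toSubmodule A)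
      (Subalgebra.toSubmodule A)
  have hr : ∀ a : A, (Bialgebra.comulAlgHom k O).comp A.val a ∈ ψ.range := by
    intro a
    refine Submodule.span_le (p := Subalgebra.toSubmodule ψ.range).2 ?_ (hA.comul_mem a a.2)
    rintro _ ⟨b, hb, c, hc, rfl⟩
    exact ⟨⟨b, hb⟩ ⊗ₜ ⟨c, hc⟩, by simp [ψ]⟩
  refine ⟨(AlgEquiv.ofInjective ψ hψ).symm.toAlgHom.comp
    (((Bialgebra.comulAlgHom k O).comp A.val).codRestrict ψ.range hr), fun a => ?_⟩
  have := congrArg Subtype.val ((AlgEquiv.ofInjective ψ hψ).apply_symm_apply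
    (((Bialgebra.comulAlgHom k O).comp A.val).codRestrict ψ.range hr a))
  exact this

theorem map_map_apply {R₁ R₂ R₃ S₁ S₂ S₃ : Type*} [CommRing R₁] [CommRing R₂] [CommRing R₃]
    [CommRing S₁] [CommRing S₂] [CommRing S₃] [Algebra k R₁] [Algebra k R₂] [Algebra k R₃]
    [Algebra k S₁] [Algebra k S₂] [Algebra k S₃] (f : R₁ →ₐ[k] R₂) (g : S₁ →ₐ[k] S₂)
    (f' : R₂ →ₐ[k] R₃) (g' : S₂ →ₐ[k] S₃) (z : R₁ ⊗[k] S₁) :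
    Algebra.TensorProduct.map f' g' (Algebra.TensorProduct.map f g z) =
      Algebra.TensorProduct.map (f'.comp f) (g'.comp g) z := by
  rw [Algebra.TensorProduct.map_comp, AlgHom.comp_apply]

theorem IsHopfSub.algebraMap_counit_eq_zero (hA : IsHopfSub k O A) {D : A →ₐ[k] A ⊗[k] A}
    (hD : ∀ a : A, Algebra.TensorProduct.map A.val A.val (D a) = Coalgebra.comul (R := k) (a : O))
    {R : Type*} [CommRing R] [Algebra k R] (π : A →ₐ[k] R) (i : A)
    (h : Algebra.TensorProduct.map π (AlgHom.id k O)
      (Algebra.TensorProduct.map (AlgHom.id k A) A.val (D i)) = 0) :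
    algebraMap k R (Coalgebra.counit (R := k) (i : O)) = 0 := by
  have h₃ : Algebra.TensorProduct.map (AlgHom.id k R) A.val
      (Algebra.TensorProduct.map π (AlgHom.id k A) (D i)) = 0 := by
    rw [map_map_apply] at h ⊢
    exact h
  have hinj : Function.Injective (Algebra.TensorProduct.map (AlgHom.id k R) A.val) :=
    Module.Flat.lTensor_preserves_injective_linearMap (M := R) A.val.toLinearMap
      Subtype.val_injective
  have h₄ : Algebra.TensorProduct.map π (AlgHom.id k A) (D i) = 0 :=
    hinj (h₃.trans (map_zero _).symm)
  let S : A →ₗ[k] A := ((HopfAlgebra.antipode k).comp A.val.toLinearMap).codRestrict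
    (Subalgebra.toSubmodule A) fun a => hA.antipode_mem a a.2
  have hS : LinearMap.mul' k A ((S.lTensor A) (D i)) =
      algebraMap k A (Coalgebra.counit (R := k) (i : O)) := by
    refine Subtype.ext ((?_ : _ = _).trans
      (HopfAlgebra.mul_antipode_lTensor_comul_apply (R := k) (i : O)))
    rw [← hD]
    generalize D i = z
    induction z with
    | zero => simp
    | add x y hx hy => simp only [map_add, ← hx, ← hy]; rfl
    | tmul x y => rfl
  have h₅ : π (LinearMap.mul' k A ((S.lTensor A) (D i))) =
      LinearMap.mul' k R (((π.toLinearMap ∘ₗ S).lTensor R)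
        (Algebra.TensorProduct.map π (AlgHom.id k A) (D i))) := by
    generalize D i = z
    induction z with
    | zero => simp
    | add x y hx hy => simp only [map_add, hx, hy]
    | tmul x y => simp
  rw [h₄, map_zero, map_zero, hS, AlgHom.commutes] at h₅
  exact h₅

/-- A Hopf subalgebra has no non-trivial ideals `I` with `Δ(I) ⊆ I ⊗ O`. -/
theorem IsHopfSub.eq_bot_or_eq_top (hA : IsHopfSub k O A) {D : A →ₐ[k] A ⊗[k] A}
    (hD : ∀ a : A, Algebra.TensorProduct.map A.val A.val (D a) = Coalgebra.comul (R := k) (a : O))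
    (I : Ideal A)
    (hI : I.map ((Algebra.TensorProduct.map (AlgHom.id k A) A.val).comp D) ≤
      I.map (Algebra.TensorProduct.includeLeft : A →ₐ[k] A ⊗[k] O)) : I = ⊥ ∨ I = ⊤ := by
  by_cases hε : ∀ i ∈ I, Coalgebra.counit (R := k) (i : O) = 0
  · left
    refine (Submodule.eq_bot_iff _).2 fun i hi => ?_
    let E' : O ⊗[k] O →ₐ[k] O :=
      Algebra.TensorProduct.lift ((Algebra.ofId k O).comp (Bialgebra.counitAlgHom k O))
        (AlgHom.id k O) fun _ _ => Commute.all _ _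
    let E : A ⊗[k] O →ₐ[k] O := E'.comp (Algebra.TensorProduct.map A.val (AlgHom.id k O))
    have hE' : ∀ x : O, E' (Coalgebra.comul (R := k) x) = x := by
      intro x
      have h := congrArg (TensorProduct.lid k O) (Coalgebra.rTensor_counit_comul (R := k) x)
      have hl : E'.toLinearMap = (TensorProduct.lid k O).toLinearMap ∘ₗ
          (Coalgebra.counit (R := k)).rTensor O := by
        ext u v
        simp [E', Algebra.smul_def]
      rw [TensorProduct.lid_tmul, one_smul] at h
      exact (LinearMap.congr_fun hl _).trans h
    have h₁ : I.map (Algebra.TensorProduct.includeLeft : A →ₐ[k] A ⊗[k] O) ≤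
        RingHom.ker E := by
      refine Ideal.map_le_iff_le_comap.2 fun a ha => ?_
      simp [RingHom.mem_ker, E, E', hε a ha]
    have h₂ := h₁ (hI (Ideal.mem_map_of_mem _ hi))
    rw [RingHom.mem_ker] at h₂
    have h₃ : E (((Algebra.TensorProduct.map (AlgHom.id k A) A.val).comp D) i) =
        E' (Algebra.TensorProduct.map A.val A.val (D i)) :=
      congrArg E' (map_map_apply (AlgHom.id k A) A.val A.val (AlgHom.id k O) (D i))
    rw [h₃, hD, hE'] at h₂
    exact Subtype.ext h₂
  · right
    push Not at hε
    obtain ⟨i, hi, hi0⟩ := hε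
    let π : A →ₐ[k] A ⧸ I := Ideal.Quotient.mkₐ k I
    have h₁ : I.map (Algebra.TensorProduct.includeLeft : A →ₐ[k] A ⊗[k] O) ≤
        RingHom.ker (Algebra.TensorProduct.map π (AlgHom.id k O)) := by
      refine Ideal.map_le_iff_le_comap.2 fun a ha => ?_
      simp [RingHom.mem_ker, π, Ideal.Quotient.eq_zero_iff_mem.2 ha]
    have h₂ := hA.algebraMap_counit_eq_zero hD π i (h₁ (hI (Ideal.mem_map_of_mem _ hi)))
    rw [← AlgHom.commutes π] at h₂
    exact Ideal.eq_top_of_isUnit_mem _ (Ideal.Quotient.eq_zero_iff_mem.1 h₂)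
      ((IsUnit.mk0 _ hi0).map _)

theorem IsHopfSub.mem_ker_linearCombination_iff {n : ℕ} (c : Fin n → O) (a : Fin n → A) :
    a ∈ LinearMap.ker (Fintype.linearCombination A
      ((LinearMap.range (Algebra.linearMap A O)).mkQ ∘ c)) ↔ ∑ i, (a i : O) * c i ∈ A := by
  have : Fintype.linearCombination A ((LinearMap.range (Algebra.linearMap A O)).mkQ ∘ c) a =
      (LinearMap.range (Algebra.linearMap A O)).mkQ (∑ i, (a i : O) * c i) := by
    simp only [Fintype.linearCombination_apply, Function.comp_apply, map_sum]
    rfl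
  rw [LinearMap.mem_ker, this, Submodule.mkQ_apply, Submodule.Quotient.mk_eq_zero]
  exact ⟨by rintro ⟨x, hx⟩; rw [← hx]; exact x.2, fun h => ⟨⟨_, h⟩, rfl⟩⟩

theorem basis_repr_map_val {ι : Type*} (b : Module.Basis ι k O) (z : A ⊗[k] O) (α : ι) :
    (Algebra.TensorProduct.basis O b).repr
      (Algebra.TensorProduct.map A.val (AlgHom.id k O) z) α =
      ((Algebra.TensorProduct.basis A b).repr z α : O) := by
  induction z with
  | zero => simp
  | add z₁ z₂ h₁ h₂ => simp [h₁, h₂]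
  | tmul u v =>
    simp only [Algebra.TensorProduct.map_tmul, Algebra.TensorProduct.basis_repr_tmul]
    simp

theorem IsHopfSub.vecMul_mem_span {D : A →ₐ[k] A ⊗[k] A}
    (hD : ∀ a : A, Algebra.TensorProduct.map A.val A.val (D a) = Coalgebra.comul (R := k) (a : O))
    {n : ℕ} (c : Fin n → O) (t : Matrix (Fin n) (Fin n) O)
    (hc : ∀ j, Coalgebra.comul (R := k) (c j) = ∑ i, c i ⊗ₜ[k] t j i)
    (K : Submodule A (Fin n → A)) (hmem : ∀ a : Fin n → A, a ∈ K ↔ ∑ i, (a i : O) * c i ∈ A)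
    (a : Fin n → A) (ha : a ∈ K) :
    Matrix.vecMul ((Algebra.TensorProduct.map (AlgHom.id k A) A.val).comp D ∘ a)
        (((Algebra.TensorProduct.includeRight : O →ₐ[k] A ⊗[k] O) :
          O →+* A ⊗[k] O).mapMatrix t) ∈
      Submodule.span (A ⊗[k] O) {x : Fin n → A ⊗[k] O | ∃ a' ∈ K,
        x = (Algebra.TensorProduct.includeLeft : A →ₐ[k] A ⊗[k] O) ∘ a'} := by
  classical
  let d := (Algebra.TensorProduct.map (AlgHom.id k A) A.val).comp D
  let j : A →ₐ[k] A ⊗[k] O := Algebra.TensorProduct.includeLeft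
  let ι := Algebra.TensorProduct.map A.val (AlgHom.id k O)
  have hd : ∀ a : A, ι (d a) = Coalgebra.comul (R := k) (a : O) := fun a => by
    rw [← hD]
    exact map_map_apply (AlgHom.id k A) A.val A.val (AlgHom.id k O) (D a)
  let J : O →+* A ⊗[k] O := (Algebra.TensorProduct.includeRight : O →ₐ[k] A ⊗[k] O)
  change Matrix.vecMul (d ∘ a) (J.mapMatrix t) ∈ Submodule.span (A ⊗[k] O) {x | ∃ a' ∈ K, x = j ∘ a'}
  set y := Matrix.vecMul (d ∘ a) (J.mapMatrix t) with hy
  let b := Module.Basis.ofVectorSpace k O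
  let bA := Algebra.TensorProduct.basis A b
  let bO := Algebra.TensorProduct.basis O b
  have hcoord : ∀ (z : A ⊗[k] O) α, bO.repr (ι z) α = (bA.repr z α : O) := basis_repr_map_val b
  have hyc : ∑ i, c i • ι (y i) = Coalgebra.comul (R := k) (∑ i, (a i : O) * c i) := by
    have hJ : ∀ o, ι (J o) = 1 ⊗ₜ o := fun o => by simp [ι, J]
    simp only [hy, Matrix.vecMul, dotProduct, map_sum, Bialgebra.comul_mul, hc, map_mul,
      Function.comp_apply, hd, RingHom.mapMatrix_apply, Matrix.map_apply, hJ,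
      Finset.smul_sum, Finset.mul_sum]
    rw [Finset.sum_comm]
    refine Finset.sum_congr rfl fun l _ => Finset.sum_congr rfl fun i _ => ?_
    rw [← mul_smul_comm, TensorProduct.smul_tmul', smul_eq_mul, mul_one]
  have hκ : ∀ α, (fun i => bA.repr (y i) α) ∈ K := by
    intro α
    have ha' := (hmem a).1 ha
    rw [hmem]
    have h' := hcoord (d ⟨_, ha'⟩) α
    rw [hd] at h'
    have h : bO.repr (∑ i, c i • ι (y i)) α = _ := (congrArg (fun z => bO.repr z α) hyc).trans h'
    have h₂ : bO.repr (∑ i, c i • ι (y i)) α = ∑ i, (bA.repr (y i) α : O) * c i := by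
      rw [map_sum, Finsupp.finsetSum_apply]
      refine Finset.sum_congr rfl fun i _ => ?_
      rw [map_smul, Finsupp.smul_apply, hcoord, smul_eq_mul, mul_comm]
    rw [← h₂, h]
    exact Subtype.property _
  have hsum : y = ∑ α ∈ Finset.univ.biUnion fun i => (bA.repr (y i)).support,
      J (b α) • (j ∘ fun i => bA.repr (y i) α) := by
    funext i
    conv_lhs => rw [← bA.linearCombination_repr (y i), Finsupp.linearCombination_apply,
      Finsupp.sum]
    rw [Finset.sum_apply]
    refine (Finset.sum_subset (Finset.subset_biUnion_of_mem
      (fun i => (bA.repr (y i)).support) (Finset.mem_univ i)) fun α _ hα => ?_).trans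
      (Finset.sum_congr rfl fun α _ => ?_)
    · rw [Finsupp.notMem_support_iff.1 hα, zero_smul]
    · simp [bA, J, j, TensorProduct.smul_tmul']
  rw [hsum]
  exact Submodule.sum_mem _ fun α _ => Submodule.smul_mem _ _
    (Submodule.subset_span ⟨_, hκ α, rfl⟩)

theorem flat_range_of_retraction {R M N : Type*} [CommRing R] [AddCommGroup M] [Module R M]
    [AddCommGroup N] [Module R N] [Module.Flat R M] (φ : M →ₗ[R] N)
    (f : M →ₗ[R] LinearMap.ker φ) (hf : ∀ x : LinearMap.ker φ, f x = x) :
    Module.Flat R (LinearMap.range φ) := by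
  have hker : LinearMap.ker φ ≤ LinearMap.ker (LinearMap.id - (LinearMap.ker φ).subtype ∘ₗ f) :=
    fun x hx => by simp [hf ⟨x, hx⟩]
  refine Module.Flat.of_retract
    ((LinearMap.ker φ).liftQ (LinearMap.id - (LinearMap.ker φ).subtype ∘ₗ f) hker ∘ₗ
      φ.quotKerEquivRange.symm.toLinearMap) φ.rangeRestrict ?_
  refine LinearMap.ext fun x => ?_
  obtain ⟨x, rfl⟩ := φ.quotKerEquivRange.surjective x
  obtain ⟨x, rfl⟩ := Submodule.mkQ_surjective _ x
  have : φ (f x) = 0 := (f x).2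
  refine Subtype.ext ?_
  simp [this]

theorem IsHopfSub.flat_range (hA : IsHopfSub k O A) {n : ℕ} (c : Fin n → O)
    (t t' : Matrix (Fin n) (Fin n) O)
    (hc : ∀ j, Coalgebra.comul (R := k) (c j) = ∑ i, c i ⊗ₜ[k] t j i) (ht : t * t' = 1) :
    Module.Flat A (LinearMap.range (Fintype.linearCombination A
      ((LinearMap.range (Algebra.linearMap A O)).mkQ ∘ c))) := by
  classical
  obtain ⟨D, hD⟩ := hA.exists_comul
  set K := LinearMap.ker (Fintype.linearCombination A
      ((LinearMap.range (Algebra.linearMap A O)).mkQ ∘ c)) with hKdef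
  let J : O →+* A ⊗[k] O := (Algebra.TensorProduct.includeRight : O →ₐ[k] A ⊗[k] O)
  have hT : J.mapMatrix t * J.mapMatrix t' = 1 := by rw [← map_mul, ht, map_one]
  have hK := IsHopfSub.vecMul_mem_span hD c t hc K (IsHopfSub.mem_ker_linearCombination_iff c)
  have hr : ∃ r, minorIdeal K (r + 1) = ⊥ := ⟨n, minorIdeal_eq_bot_of_lt K (Nat.lt_succ_self n)⟩
  have htop : minorIdeal K (Nat.find hr) = ⊤ := by
    rcases h : Nat.find hr with _ | m
    · exact minorIdeal_zero K
    · refine (hA.eq_bot_or_eq_top hD _ ?_).resolve_left (Nat.find_min hr (h ▸ Nat.lt_succ_self m))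
      exact map_minorIdeal_le (((Algebra.TensorProduct.map (AlgHom.id k A) A.val).comp D :
        A →ₐ[k] A ⊗[k] O) : A →+* A ⊗[k] O)
        ((Algebra.TensorProduct.includeLeft : A →ₐ[k] A ⊗[k] O) : A →+* A ⊗[k] O) K _ _ hT hK _
  obtain ⟨f, hf⟩ := exists_retraction K _ htop (Nat.find_spec hr)
  exact flat_range_of_retraction _ f hf

theorem IsHopfSub.flat_quotient (hA : IsHopfSub k O A) :
    Module.Flat A (O ⧸ LinearMap.range (Algebra.linearMap A O)) := by
  refine Module.Flat.of_forall_isTrivialRelation fun {l f x} hfx => ?_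
  choose y hy using fun i => Submodule.mkQ_surjective _ (x i)
  obtain ⟨n, c, t, t', hyc, hc, ht⟩ := exists_matrix_coaction (k := k) y
  have hflat := hA.flat_range c t t' hc ht
  set N := LinearMap.range (Fintype.linearCombination A
      ((LinearMap.range (Algebra.linearMap A O)).mkQ ∘ c)) with hN
  have hx : ∀ i, x i ∈ N := by
    intro i
    obtain ⟨e, he⟩ := (Submodule.mem_span_range_iff_exists_fun k).1 (hyc i)
    refine ⟨fun l => algebraMap k A (e l), ?_⟩
    rw [← hy, ← he, map_sum, Fintype.linearCombination_apply]
    refine Finset.sum_congr rfl fun l _ => ?_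
    rw [← algebraMap_smul A (e l) (c l), map_smul]
    rfl
  have hrel : ∑ i, f i • (⟨x i, hx i⟩ : N) = 0 := Subtype.ext (by simpa using hfx)
  obtain ⟨m, a, z, h₁, h₂⟩ := Module.Flat.isTrivialRelation_of_sum_smul_eq_zero hrel
  exact ⟨m, a, fun i => z i, fun i => by simpa using congrArg N.subtype (h₁ i), h₂⟩

end HopfSubalgebra

section Coinvariants

variable {k : Type} [Field k] {O : Type} [CommRing O] [HopfAlgebra k O] {A : Subalgebra k O}

theorem mem_of_tmul_one_eq [Module.Flat A (O ⧸ LinearMap.range (Algebra.linearMap A O))] (o : O)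
    (h : o ⊗ₜ[A] (1 : O) = 1 ⊗ₜ[A] o) : o ∈ A := by
  let Q := O ⧸ LinearMap.range (Algebra.linearMap A O)
  let p : O →ₗ[A] Q := (LinearMap.range (Algebra.linearMap A O)).mkQ
  have h1 : p 1 = 0 := (Submodule.Quotient.mk_eq_zero _).2 ⟨1, by simp⟩
  have h2 := congrArg (p.rTensor O) h
  rw [LinearMap.rTensor_tmul, LinearMap.rTensor_tmul, h1, TensorProduct.zero_tmul] at h2
  have hinj := Module.Flat.lTensor_preserves_injective_linearMap (M := Q)
    (Algebra.linearMap A O) Subtype.val_injective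
  have h3 : p o ⊗ₜ[A] (1 : A) = 0 := hinj (by simpa using h2)
  have h4 : p o = 0 := by simpa using congrArg (TensorProduct.rid A Q) h3
  obtain ⟨x, hx⟩ := (Submodule.Quotient.mk_eq_zero _).1 h4
  rw [← hx]
  exact x.2

/-- The algebra map `x ↦ Σ S(x₁) ⊗ x₂` from `O` to `O ⊗_A O`. -/
noncomputable def antipodeComul (A : Subalgebra k O) : O →ₐ[k] O ⊗[A] O :=
  (Algebra.TensorProduct.lift
    ((Algebra.TensorProduct.includeLeft : O →ₐ[k] O ⊗[A] O).comp (HopfAlgebra.antipodeAlgHom k O))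
    ((Algebra.TensorProduct.includeRight : O →ₐ[A] O ⊗[A] O).restrictScalars k)
    fun _ _ => Commute.all _ _).comp (Bialgebra.comulAlgHom k O)

theorem antipodeComul_eq_zero (hA : IsHopfSub k O A) {a : O} (ha : a ∈ augSet k O A) :
    antipodeComul A a = 0 := by
  let f := Algebra.TensorProduct.lift
    ((Algebra.TensorProduct.includeLeft : O →ₐ[k] O ⊗[A] O).comp (HopfAlgebra.antipodeAlgHom k O))
    ((Algebra.TensorProduct.includeRight : O →ₐ[A] O ⊗[A] O).restrictScalars k)
    fun _ _ => Commute.all _ _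
  let g : O ⊗[k] O →ₗ[k] O ⊗[A] O :=
    (Algebra.TensorProduct.includeLeft : O →ₐ[k] O ⊗[A] O).toLinearMap ∘ₗ
      LinearMap.mul' k O ∘ₗ (HopfAlgebra.antipode k).rTensor O
  have hfg : Submodule.span k {x : O ⊗[k] O | ∃ b ∈ A, ∃ c ∈ A, x = b ⊗ₜ[k] c} ≤
      LinearMap.eqLocus f.toLinearMap g := by
    refine Submodule.span_le.2 ?_
    rintro _ ⟨b, hb, c, hc, rfl⟩
    have : (HopfAlgebra.antipode k b * c) ⊗ₜ[A] (1 : O) = HopfAlgebra.antipode k b ⊗ₜ[A] c := by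
      have := TensorProduct.smul_tmul (R := A) (⟨c, hc⟩ : A) (HopfAlgebra.antipode k b) (1 : O)
      simpa [Algebra.smul_def, mul_comm] using this
    simp [f, g, this]
  have h := hfg (hA.comul_mem a ha.1)
  refine (h : f _ = g _).trans ?_
  simp only [g, LinearMap.comp_apply]
  rw [HopfAlgebra.mul_antipode_rTensor_comul_apply, ha.2, map_zero, map_zero]

theorem lift_antipodeComul_comul (o : O) :
    Algebra.TensorProduct.lift (Algebra.TensorProduct.includeLeft : O →ₐ[k] O ⊗[A] O)
      (antipodeComul A) (fun _ _ => Commute.all _ _) (Coalgebra.comul (R := k) o) =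
        1 ⊗ₜ[A] o := by
  let F : O ⊗[k] O →ₗ[k] O ⊗[A] O :=
    (Algebra.TensorProduct.lift (Algebra.TensorProduct.includeLeft : O →ₐ[k] O ⊗[A] O)
      ((Algebra.TensorProduct.includeRight : O →ₐ[A] O ⊗[A] O).restrictScalars k)
      fun _ _ => Commute.all _ _).toLinearMap
  have hF : ∀ x y : O, F (x ⊗ₜ y) = x ⊗ₜ[A] y := fun x y => by simp [F]
  let G : O ⊗[k] O ⊗[k] O →ₗ[k] O ⊗[A] O :=
    F ∘ₗ (LinearMap.mul' k O ∘ₗ (HopfAlgebra.antipode k).lTensor O).rTensor O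
  have h₁ : (Algebra.TensorProduct.lift (Algebra.TensorProduct.includeLeft : O →ₐ[k] O ⊗[A] O)
      (antipodeComul A) (fun _ _ => Commute.all _ _)).toLinearMap =
      G ∘ₗ (TensorProduct.assoc k O O O).symm.toLinearMap ∘ₗ
        (Coalgebra.comul (R := k)).lTensor O := by
    ext x y
    simp only [TensorProduct.AlgebraTensorModule.curry_apply, TensorProduct.curry_apply,
      LinearMap.coe_restrictScalars, AlgHom.toLinearMap_apply, LinearMap.comp_apply,
      LinearMap.lTensor_tmul, Algebra.TensorProduct.lift_tmul, antipodeComul, AlgHom.comp_apply,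
      Bialgebra.comulAlgHom_apply, LinearEquiv.coe_coe]
    generalize Coalgebra.comul (R := k) y = z
    induction z with
    | zero => simp
    | add z₁ z₂ h₁ h₂ => simp only [map_add, mul_add, TensorProduct.tmul_add, h₁, h₂]
    | tmul u v => simp [G, hF]
  refine (LinearMap.congr_fun h₁ (Coalgebra.comul (R := k) o)).trans ?_
  simp only [LinearMap.comp_apply, LinearEquiv.coe_coe]
  rw [← Coalgebra.coassoc_apply, LinearEquiv.symm_apply_apply]
  simp only [G, LinearMap.comp_apply]
  rw [← LinearMap.rTensor_comp_apply, LinearMap.comp_assoc, HopfAlgebra.mul_antipode_lTensor_comul,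
    LinearMap.rTensor_comp_apply, Coalgebra.rTensor_counit_comul]
  simp [hF]

variable {L : Type} [CommRing L] [HopfAlgebra k L] {q : O →ₐc[k] L}

theorem mem_of_lTensor_comul_eq (hA : IsHopfSub k O A) (hq : IsQuotientHopf k O L A q) (o : O)
    (h : (q : O →ₗ[k] L).lTensor O (Coalgebra.comul (R := k) o) = o ⊗ₜ q 1) : o ∈ A := by
  have := hA.flat_quotient
  refine mem_of_tmul_one_eq o ?_
  let Θ := Algebra.TensorProduct.lift (Algebra.TensorProduct.includeLeft : O →ₐ[k] O ⊗[A] O)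
      (antipodeComul A) (fun _ _ => Commute.all _ _)
  have hker : RingHom.ker (Algebra.TensorProduct.map (AlgHom.id k O) (q : O →ₐ[k] L)) ≤
      RingHom.ker Θ := by
    rw [Algebra.TensorProduct.lTensor_ker _ hq.surj, hq.ker, Ideal.map_span, Ideal.span_le]
    rintro _ ⟨a, ha, rfl⟩
    simp [RingHom.mem_ker, Θ, antipodeComul_eq_zero hA ha]
  have hmem : Coalgebra.comul (R := k) o - o ⊗ₜ 1 ∈
      RingHom.ker (Algebra.TensorProduct.map (AlgHom.id k O) (q : O →ₐ[k] L)) := by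
    rw [RingHom.mem_ker, map_sub, sub_eq_zero]
    exact h
  have h' := hker hmem
  rw [RingHom.mem_ker, map_sub, sub_eq_zero] at h'
  rw [← lift_antipodeComul_comul (k := k) (A := A) o]
  refine (h'.trans ?_).symm
  simp [Θ]

theorem IsQuotientHopf.apply_eq (hq : IsQuotientHopf k O L A q) {a : O} (ha : a ∈ A) :
    q a = algebraMap k L (Coalgebra.counit (R := k) a) := by
  have h : a - algebraMap k O (Coalgebra.counit (R := k) a) ∈ RingHom.ker (q : O →ₐ[k] L) := by
    rw [hq.ker]
    exact Ideal.subset_span ⟨sub_mem ha (A.algebraMap_mem _), by simp⟩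
  rw [RingHom.mem_ker, map_sub, AlgHom.commutes, sub_eq_zero] at h
  exact h

theorem rTensor_comul_eq (hA : IsHopfSub k O A) (hq : IsQuotientHopf k O L A q) {a : O}
    (ha : a ∈ A) : (q : O →ₗ[k] L).rTensor O (Coalgebra.comul (R := k) a) = q 1 ⊗ₜ a := by
  have hle : Submodule.span k {x : O ⊗[k] O | ∃ b ∈ A, ∃ c ∈ A, x = b ⊗ₜ[k] c} ≤
      LinearMap.eqLocus ((q : O →ₗ[k] L).rTensor O)
        ((Algebra.linearMap k L).rTensor O ∘ₗ (Coalgebra.counit (R := k)).rTensor O) := by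
    refine Submodule.span_le.2 ?_
    rintro _ ⟨b, hb, c, -, rfl⟩
    simpa using congrArg (· ⊗ₜ[k] c) (hq.apply_eq hb)
  refine (hle (hA.comul_mem a ha)).trans ?_
  rw [LinearMap.comp_apply, Coalgebra.rTensor_counit_comul]
  simp

end Coinvariants

theorem exists_eq_sum_tmul_linearIndependent {k V U : Type*} [Field k] [AddCommGroup V]
    [Module k V] [AddCommGroup U] [Module k U] (z : V ⊗[k] U) :
    ∃ (n : ℕ) (c : Fin n → V) (u : Fin n → U), LinearIndependent k c ∧
      z = ∑ i, c i ⊗ₜ[k] u i := by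
  classical
  let b := Module.Basis.ofVectorSpace k V
  let f := TensorProduct.equivFinsuppOfBasisLeft (N := U) b z
  have hz : z = ∑ i ∈ f.support, b i ⊗ₜ[k] f i := by
    rw [← (TensorProduct.equivFinsuppOfBasisLeft (N := U) b).symm_apply_apply z,
      TensorProduct.equivFinsuppOfBasisLeft_symm_apply]
    rfl
  let e := f.support.equivFin.symm
  refine ⟨_, fun i => b (e i), fun i => f (e i),
    b.linearIndependent.comp _ (Subtype.val_injective.comp e.injective), ?_⟩
  rw [e.sum_comp fun i => b i ⊗ₜ[k] f i, Finset.sum_coe_sort f.support fun i => b i ⊗ₜ[k] f i]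
  exact hz

end PaperQuotient

open PaperQuotient in
/-- For a right `O`-comodule `V`, the subspace
`V^{co L} = {v | (id ⊗ q)(ρ_V v) = v ⊗ q 1}` of `L`-coinvariants satisfies
`ρ_V (V^{co L}) ⊆ V^{co L} ⊗ A`; in particular it is an `O`-subcomodule whose
coaction factors through `A`. -/
theorem statement7
    (k : Type) [Field k] (O : Type) [CommRing O] [HopfAlgebra k O]
    (A : Subalgebra k O) (hA : IsHopfSub k O A)
    (L : Type) [CommRing L] [HopfAlgebra k L]
    (q : O →ₐc[k] L) (hq : IsQuotientHopf k O L A q)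
    (V : Type) [AddCommGroup V] [Module k V]
    (ρV : V →ₗ[k] V ⊗[k] O) (hV : IsComod k O ρV) :
    ∀ v ∈ LinearMap.ker ((resCoact k O L q ρV) - (TensorProduct.mk k V L).flip (q 1)),
      ρV v ∈ Submodule.span k
        {x : V ⊗[k] O |
          ∃ w ∈ LinearMap.ker ((resCoact k O L q ρV) - (TensorProduct.mk k V L).flip (q 1)),
            ∃ a ∈ A, x = w ⊗ₜ[k] a} := by
  have hcoinv : ∀ w, w ∈ LinearMap.ker
      ((resCoact k O L q ρV) - (TensorProduct.mk k V L).flip (q 1)) ↔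
        (q : O →ₗ[k] L).lTensor V (ρV w) = w ⊗ₜ q 1 := fun w => by
    rw [LinearMap.mem_ker, LinearMap.sub_apply, sub_eq_zero]
    rfl
  intro v hv
  rw [hcoinv] at hv
  obtain ⟨n, c, o, hc, hρ⟩ := exists_eq_sum_tmul_linearIndependent (ρV v)
  have ho : ∀ i, o i ∈ A := by
    have hl : (TensorProduct.assoc k V O L).toLinearMap ∘ₗ ρV.rTensor L ∘ₗ
        (q : O →ₗ[k] L).lTensor V =
        ((q : O →ₗ[k] L).lTensor O).lTensor V ∘ₗ (TensorProduct.assoc k V O O).toLinearMap ∘ₗ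
          TensorProduct.map ρV LinearMap.id := by
      ext x y
      simp only [TensorProduct.AlgebraTensorModule.curry_apply, TensorProduct.curry_apply,
        LinearMap.coe_restrictScalars, LinearMap.comp_apply, LinearMap.lTensor_tmul,
        LinearMap.rTensor_tmul, TensorProduct.map_tmul, LinearMap.id_apply]
      generalize ρV x = z
      induction z with
      | zero => simp
      | add z₁ z₂ h₁ h₂ => simp only [map_add, TensorProduct.add_tmul, h₁, h₂]
      | tmul u v => simp
    have h := LinearMap.congr_fun hl (ρV v)
    simp only [LinearMap.comp_apply, LinearEquiv.coe_coe, hv, hV.coassoc, LinearMap.rTensor_tmul]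
      at h
    simp only [hρ, map_sum, TensorProduct.sum_tmul, TensorProduct.assoc_tmul,
      TensorProduct.map_tmul, LinearMap.lTensor_tmul, LinearMap.id_apply] at h
    exact fun i => mem_of_lTensor_comul_eq hA hq _ (congrFun (sum_tmul_injective hc h) i).symm
  obtain ⟨m, a, w, ha, hz⟩ := exists_eq_sum_tmul_linearIndependent
    (∑ i, (⟨o i, ho i⟩ : A) ⊗ₜ[k] c i)
  have hρ' : ρV v = ∑ i, w i ⊗ₜ[k] (a i : O) := by
    have h := congrArg ((TensorProduct.comm k O V).toLinearMap ∘ₗ A.val.toLinearMap.rTensor V) hz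
    simp only [map_sum, LinearMap.comp_apply, LinearMap.rTensor_tmul, LinearEquiv.coe_coe,
      TensorProduct.comm_tmul] at h
    exact hρ.trans h
  have ha' : LinearIndependent k fun i => (a i : O) :=
    ha.map' A.val.toLinearMap (LinearMap.ker_eq_bot.2 Subtype.val_injective)
  have hw : ∀ i, (q : O →ₗ[k] L).lTensor V (ρV (w i)) = w i ⊗ₜ q 1 := by
    have hl : (TensorProduct.assoc k V L O).toLinearMap ∘ₗ
        ((q : O →ₗ[k] L).lTensor V ∘ₗ ρV).rTensor O =
        ((q : O →ₗ[k] L).rTensor O).lTensor V ∘ₗ (TensorProduct.assoc k V O O).toLinearMap ∘ₗ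
          TensorProduct.map ρV LinearMap.id := by
      ext x y
      simp only [TensorProduct.AlgebraTensorModule.curry_apply, TensorProduct.curry_apply,
        LinearMap.coe_restrictScalars, LinearMap.comp_apply,
        LinearMap.rTensor_tmul, TensorProduct.map_tmul, LinearMap.id_apply]
      generalize ρV x = z
      induction z with
      | zero => simp
      | add z₁ z₂ h₁ h₂ => simp only [map_add, TensorProduct.add_tmul, h₁, h₂]
      | tmul u v => simp
    have h := LinearMap.congr_fun hl (ρV v)
    simp only [LinearMap.comp_apply, LinearEquiv.coe_coe, hV.coassoc] at h
    simp only [hρ', map_sum, TensorProduct.map_tmul, LinearMap.lTensor_tmul, LinearMap.id_apply,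
      LinearMap.rTensor_tmul, LinearMap.comp_apply, rTensor_comul_eq hA hq (a _).2] at h
    have h' := congrArg ((TensorProduct.comm k (V ⊗[k] L) O).toLinearMap ∘ₗ
      (TensorProduct.assoc k V L O).symm.toLinearMap) h
    simp only [map_sum, LinearMap.comp_apply, LinearEquiv.coe_coe, LinearEquiv.symm_apply_apply,
      TensorProduct.assoc_symm_tmul, TensorProduct.comm_tmul] at h'
    exact congrFun (sum_tmul_injective ha' h')
  rw [hρ']
  exact Submodule.sum_mem _ fun i _ =>
    Submodule.subset_span ⟨w i, (hcoinv _).2 (hw i), a i, (a i).2, rfl⟩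
end
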